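/- arXiv:1607.01377 — 3 statements merged into one kernel-verified Lean document; each statement's English description precedes it below -/
import Mathlib

section
/- Suppose H is an algebraic k-hypergraph and κ is an infinite cardinal. The following are equivalent: (1) χ(H) ≤ κ; (2) for every d and every d-dimensional k-template P, if L(ℝ^d,P) is embeddable into H then χ(L(ℝ^d,P)) ≤ κ; (3) for every (k−1)-dimensional k-template P, if L(ℝ^{k−1},P) is semialgebraically immersible into H then χ(L(ℝ^{k−1},P)) ≤ κ. -/
open Cardinal

universe u v

/-- `f` is one-to-one in each coordinate: if `a` and `b` differ in exactly one
coordinate, then `f a ≠ f b`. -/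
def OneToOneEachCoord {d : ℕ} {X C : Type*} (f : (Fin d → X) → C) : Prop :=
  ∀ a b : Fin d → X, (∃ i, a i ≠ b i ∧ ∀ j, j ≠ i → a j = b j) → f a ≠ f b

/-- `Q` is a homomorphic image of the template `P`: there is a surjection of `P`
onto `Q` preserving coordinate equalities. -/
def IsHomImage {d : ℕ} {α β : Type*} (P : Finset (Fin d → α)) (Q : Finset (Fin d → β)) : Prop :=
  ∃ f : (Fin d → α) → (Fin d → β),
    (∀ x ∈ P, f x ∈ Q) ∧ (∀ y ∈ Q, ∃ x ∈ P, f x = y) ∧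
    (∀ x ∈ P, ∀ y ∈ P, ∀ i, x i = y i → f x i = f y i)

/-- The edge set of the template hypergraph `L(X^d, P)`: the edges are the
`k`-element subsets of `X^d` that are homomorphic images of `P`. -/
def LEdges (k : ℕ) {d : ℕ} {α : Type*} (P : Finset (Fin d → α)) (X : Type*) :
    Set (Finset (Fin d → X)) :=
  {Q | Q.card = k ∧ IsHomImage P Q}

/-- Image of a finset (with classical decidable equality). -/
noncomputable def fimg {V W : Type*} (g : V → W) (e : Finset V) : Finset W :=
  @Finset.image _ _ (Classical.decEq W) g e

/-- `g` is an embedding of the hypergraph with edge set `E₁` into the one with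
edge set `E₂`: an injection on vertices mapping every edge to an edge. -/
def IsHGEmbedding {V W : Type*} (E₁ : Set (Finset V)) (E₂ : Set (Finset W)) (g : V → W) : Prop :=
  Function.Injective g ∧ ∀ e ∈ E₁, fimg g e ∈ E₂

def Embeddable {V W : Type*} (E₁ : Set (Finset V)) (E₂ : Set (Finset W)) : Prop :=
  ∃ g, IsHGEmbedding E₁ E₂ g

/-- The hypergraph with edge set `E` has a coloring with at most `κ` colors
that is not constant on any edge. -/
def ProperlyColorable {V : Type u} (E : Set (Finset V)) (κ : Cardinal.{u}) : Prop :=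
  ∃ (C : Type u) (φ : V → C), #C ≤ κ ∧ ∀ e ∈ E, ∃ x ∈ e, ∃ y ∈ e, φ x ≠ φ y

/-- The chromatic number: the least `κ` admitting a proper `κ`-coloring. -/
noncomputable def chromaticNumber {V : Type u} (E : Set (Finset V)) : Cardinal.{u} :=
  sInf {κ | ProperlyColorable E κ}

/-- The edge set of the zero `k`-hypergraph of a `(k,n)`-ary real polynomial:
the `k`-element subsets of `ℝ^n` admitting an enumeration on which `p` vanishes. -/
def zeroEdges (k n : ℕ) (p : MvPolynomial (Fin k × Fin n) ℝ) : Set (Finset (Fin n → ℝ)) :=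
  {s | ∃ a : Fin k → (Fin n → ℝ), Function.Injective a ∧
        fimg a Finset.univ = s ∧ MvPolynomial.eval (fun v => a v.1 v.2) p = 0}

/-- An immersion of `L(X^d, P)` into the `k`-hypergraph with vertices `V` and edges `E`:
a map one-to-one in each coordinate sending every edge on which it is injective
to an edge of the target. -/
def IsImmersion {d : ℕ} {α X V : Type*} (k : ℕ) (P : Finset (Fin d → α))
    (E : Set (Finset V)) (f : (Fin d → X) → V) : Prop :=
  OneToOneEachCoord f ∧ ∀ Q ∈ LEdges k P X, Set.InjOn f ↑Q → fimg f Q ∈ E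

/-- Terms of the first-order language of ordered fields `{+,-,×,0,1,≤}`,
with variables indexed by `ℕ`. -/
inductive OFTerm : Type
  | var : ℕ → OFTerm
  | zero : OFTerm
  | one : OFTerm
  | add : OFTerm → OFTerm → OFTerm
  | mul : OFTerm → OFTerm → OFTerm
  | neg : OFTerm → OFTerm

/-- First-order formulas of the language of ordered fields (with equality;
`≠`, `∨`, `→`, `∀`, `<` etc. are expressible from `=`, `≤`, `¬`, `∧`, `∃`). -/
inductive OFFml : Type
  | eq : OFTerm → OFTerm → OFFml
  | le : OFTerm → OFTerm → OFFml
  | not : OFFml → OFFml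
  | and : OFFml → OFFml → OFFml
  | ex : ℕ → OFFml → OFFml

def OFTerm.eval (v : ℕ → ℝ) : OFTerm → ℝ
  | var i => v i
  | zero => 0
  | one => 1
  | add s t => s.eval v + t.eval v
  | mul s t => s.eval v * t.eval v
  | neg t => - t.eval v

/-- Realization (satisfaction) of a formula in the ordered field `ℝ`
under the valuation `v`. -/
def OFFml.Realize (v : ℕ → ℝ) : OFFml → Prop
  | eq s t => s.eval v = t.eval v
  | le s t => s.eval v ≤ t.eval v
  | not φ => ¬ φ.Realize v
  | and φ ψ => φ.Realize v ∧ ψ.Realize v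
  | ex i φ => ∃ r : ℝ, φ.Realize (Function.update v i r)

def OFTerm.fv : OFTerm → Finset ℕ
  | var i => {i}
  | zero => ∅
  | one => ∅
  | add s t => s.fv ∪ t.fv
  | mul s t => s.fv ∪ t.fv
  | neg t => t.fv

/-- The free variables of a formula. -/
def OFFml.fv : OFFml → Finset ℕ
  | eq s t => s.fv ∪ t.fv
  | le s t => s.fv ∪ t.fv
  | not φ => φ.fv
  | and φ ψ => φ.fv ∪ ψ.fv
  | ex i φ => φ.fv.erase i

/-- The graph of `f : ℝ^d → ℝ^n` is semialgebraic, i.e. first-order definable with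
parameters in the ordered field `ℝ`: variables `0,…,d-1` stand for the input,
`d,…,d+n-1` for the output, and all remaining variables are parameters. -/
def IsSemialgebraicGraph (d n : ℕ) (f : (Fin d → ℝ) → (Fin n → ℝ)) : Prop :=
  ∃ (θ : OFFml) (params : ℕ → ℝ),
    ∀ (z : Fin d → ℝ) (x : Fin n → ℝ),
      f z = x ↔ θ.Realize (fun i =>
        if h : i < d then z ⟨i, h⟩
        else if h' : i - d < n then x ⟨i - d, h'⟩
        else params i)

/-- A point of `X^s` is recovered from its color together with few of its coordinates. -/
theorem exists_coloring_determined {κ : Cardinal.{0}} (hκ : ℵ₀ ≤ κ) (s m : ℕ) :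
    ∀ X : Type, #X ≤ Order.succ^[m] κ →
      ∃ (ψ : (Fin s → X) → κ.out) (I : (Fin s → X) → Finset (Fin s)),
        (∀ x, (I x).card ≤ m) ∧
        ∀ x y, ψ x = ψ y → I x = I y → (∀ i ∈ I x, x i = y i) → x = y := by
  induction m with
  | zero =>
    intro X hX
    have h : #(Fin s → X) ≤ #κ.out := by
      simp only [mk_out, mk_pi, prod_const, lift_id, mk_fin, Function.iterate_zero,
        id] at hX ⊢
      exact (power_le_power_right hX).trans (power_nat_le hκ)
    obtain ⟨ψ⟩ := h
    exact ⟨ψ, fun _ => ∅, by simp, fun x y h _ _ => ψ.injective h⟩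
  | succ m ih =>
    intro X hX
    rcases Nat.eq_zero_or_pos s with rfl | hs
    · obtain ⟨c⟩ : Nonempty κ.out := by
        rw [← mk_ne_zero_iff, mk_out]; exact (aleph0_pos.trans_le hκ).ne'
      exact ⟨fun _ => c, fun _ => ∅, by simp, fun x y _ _ _ => Subsingleton.elim _ _⟩
    have : Nonempty (Fin s) := ⟨⟨0, hs⟩⟩
    have hm : ℵ₀ ≤ Order.succ^[m] κ := hκ.trans (Order.le_succ_iterate m κ)
    obtain ⟨_, _, hr⟩ := exists_ord_eq_type_lt X
    have hseg (z : X) : #(Set.Iic z) ≤ Order.succ^[m] κ := by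
      have h1 : #(Set.Iio z) ≤ Order.succ^[m] κ := by
        rw [← Order.lt_succ_iff, ← Function.iterate_succ_apply' Order.succ m κ]
        exact (mk_Iio_lt z hr).trans_le hX
      rw [← Set.Iio_insert]
      exact mk_insert_le.trans (add_le_of_le hm h1 (one_le_aleph0.trans hm))
    choose ψ I hI hψ using fun z => ih (Set.Iic z) (hseg z)
    choose i hi using fun x : Fin s → X => Finite.exists_max x
    obtain ⟨enc⟩ : Nonempty (Fin s × κ.out × Finset (Fin s) ↪ κ.out) := by
      rw [← Cardinal.le_def]
      simp only [mk_prod, mk_out, mk_fin, lift_id]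
      refine mul_le_of_le hκ (natCast_le_aleph0.trans hκ) (mul_le_of_le hκ le_rfl ?_)
      exact (mk_le_aleph0).trans hκ
    let v (x : Fin s → X) : Fin s → Set.Iic (x (i x)) := fun j => ⟨x j, hi x j⟩
    refine ⟨fun x => enc (i x, ψ _ (v x), I _ (v x)), fun x => insert (i x) (I _ (v x)),
      fun x => (Finset.card_insert_le _ _).trans (by grind), fun x y hxy _ hI' => ?_⟩
    have h := enc.injective hxy
    simp only [Prod.mk.injEq] at h
    obtain ⟨h1, h2, h3⟩ := h
    have hz : x (i x) = y (i x) := hI' _ (by simp)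
    obtain ⟨w, hw⟩ : ∃ w : Fin s → Set.Iic (x (i x)), ∀ j, (w j : X) = y j :=
      ⟨fun j => ⟨y j, by have := hi y j; rw [← h1] at this; simpa [hz]⟩, fun _ => rfl⟩
    have key : ∀ z, ∀ hz' : x (i x) = z, ∀ u : Fin s → Set.Iic z, (∀ j, (u j : X) = y j) →
        ψ _ (v x) = ψ z u → I _ (v x) = I z u → x = y := by
      rintro z rfl u hu e1 e2
      have := hψ _ _ _ e1 e2 fun j hj => Subtype.ext (by
        rw [hu]; exact hI' j (Finset.mem_insert_of_mem hj))
      funext j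
      rw [← hu j, ← this]
    exact key _ (by rw [hz, h1]) (v y) (fun _ => rfl) h2 h3

theorem Finset.exists_separating_coords {s : ℕ} {X : Type*} (Q : Finset (Fin s → X))
    (hQ : Q.Nonempty) : ∃ I : Finset (Fin s), I.card + 1 ≤ Q.card ∧
      ∀ x ∈ Q, ∀ y ∈ Q, (∀ i ∈ I, x i = y i) → x = y := by
  classical
  induction hQ using Finset.Nonempty.cons_induction with
  | singleton a => exact ⟨∅, by simp, by simp⟩
  | cons a Q ha hQ ih =>
    obtain ⟨I, hI, h⟩ := ih
    by_cases hy : ∃ y ∈ Q, ∀ i ∈ I, a i = y i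
    · obtain ⟨y, hyQ, hy⟩ := hy
      have hne : a ≠ y := fun h => ha (h ▸ hyQ)
      obtain ⟨i, hi⟩ := Function.ne_iff.1 hne
      have key : ∀ z ∈ Q, (∀ j ∈ insert i I, a j = z j) → False := fun z hz hj => by
        have : y = z := h y hyQ z hz fun j hjI =>
          (hy j hjI).symm.trans (hj j (Finset.mem_insert_of_mem hjI))
        exact hi (this ▸ hj i (Finset.mem_insert_self _ _))
      refine ⟨insert i I, ?_, ?_⟩
      · have := Finset.card_insert_le i I
        rw [Finset.card_cons]; omega
      · simp only [Finset.mem_cons]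
        rintro x (rfl | hx) z (rfl | hz) hj
        · rfl
        · exact (key z hz hj).elim
        · exact (key x hx fun j hjI => (hj j hjI).symm).elim
        · exact h x hx z hz fun j hjI => hj j (Finset.mem_insert_of_mem hjI)
    · push Not at hy
      refine ⟨I, by rw [Finset.card_cons]; omega, ?_⟩
      simp only [Finset.mem_cons]
      rintro x (rfl | hx) z (rfl | hz) hj
      · rfl
      · obtain ⟨i, hi, hne⟩ := hy z hz
        exact (hne (hj i hi)).elim
      · obtain ⟨i, hi, hne⟩ := hy x hx
        exact (hne (hj i hi).symm).elim
      · exact h x hx z hz hj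

theorem succ_iterate_le_of_le (κ : Cardinal.{0}) {a b : ℕ} (h : a ≤ b) :
    Order.succ^[a] κ ≤ Order.succ^[b] κ := by
  obtain ⟨c, rfl⟩ := Nat.exists_eq_add_of_le' h
  rw [Function.iterate_add_apply]
  exact Order.le_succ_iterate _ _

theorem exists_coloring_template {κ : Cardinal.{0}} (hκ : ℵ₀ ≤ κ) (s k : ℕ) (hk : 2 ≤ k)
    (X : Type) :
    ∃ ψ : (Fin s → X) → κ.out, ∀ Q : Finset (Fin s → X), Q.card = k →
      (∀ x ∈ Q, ∀ y ∈ Q, ψ x = ψ y) →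
      ∃ I : Finset (Fin s), I.card ≤ k - 1 ∧ Order.succ^[I.card] κ ≤ #X ∧
        ∀ x ∈ Q, ∀ y ∈ Q, (∀ i ∈ I, x i = y i) → x = y := by
  classical
  by_cases h : ∃ m, m ≤ k - 1 ∧ #X ≤ Order.succ^[m] κ
  · obtain ⟨hm, hX⟩ := Nat.find_spec h
    have hmin : ∀ m' < Nat.find h, _ := fun m' => Nat.find_min h
    generalize Nat.find h = m at *
    obtain ⟨ψ, I, hI, hψ⟩ := exists_coloring_determined hκ s m X hX
    obtain ⟨enc⟩ : Nonempty (κ.out × Finset (Fin s) ↪ κ.out) := by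
      rw [← Cardinal.le_def]
      simp only [mk_prod, mk_out, lift_id]
      exact mul_le_of_le hκ le_rfl (mk_le_aleph0.trans hκ)
    refine ⟨fun x => enc (ψ x, I x), fun Q hQ hmono => ?_⟩
    have hmono' : ∀ x ∈ Q, ∀ y ∈ Q, ψ x = ψ y ∧ I x = I y := fun x hx y hy => by
      simpa using enc.injective (hmono x hx y hy)
    obtain ⟨a, ha, b, hb, hab⟩ := Finset.one_lt_card.1 (by omega : 1 < Q.card)
    have hsep : ∀ x ∈ Q, ∀ y ∈ Q, (∀ i ∈ I a, x i = y i) → x = y := fun x hx y hy hi =>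
      hψ x y (hmono' x hx y hy).1 (hmono' x hx y hy).2 (by rwa [(hmono' x hx a ha).2])
    refine ⟨I a, (hI a).trans hm, ?_, hsep⟩
    rcases m with _ | m
    · exact (hab (hsep a ha b hb (by simp [Finset.card_eq_zero.1 (Nat.le_zero.1 (hI a))]))).elim
    · refine (succ_iterate_le_of_le κ (hI a)).trans ?_
      rw [Function.iterate_succ_apply', Order.succ_le_iff]
      by_contra hlt
      exact hmin m (Nat.lt_succ_self m) ⟨by omega, not_lt.1 hlt⟩
  · push Not at h
    obtain ⟨c⟩ : Nonempty κ.out := by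
      rw [← mk_ne_zero_iff, mk_out]; exact (aleph0_pos.trans_le hκ).ne'
    refine ⟨fun _ => c, fun Q hQ _ => ?_⟩
    obtain ⟨I, hI, hsep⟩ := Q.exists_separating_coords (Finset.card_pos.1 (by omega))
    exact ⟨I, by omega, (h _ (by omega)).le, hsep⟩

theorem exists_monochromatic_grid {κ : Cardinal.{0}} (hκ : ℵ₀ ≤ κ) {C : Type} [Nonempty C]
    (hC : #C ≤ κ)
    {V : Type*} (r e : ℕ) :
    ∀ (X : Type), Order.succ^[e] κ ≤ #X → ∀ (φ : (Fin e → X) → C) (f : (Fin e → X) → V),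
      OneToOneEachCoord f → ∃ (A : Fin e → Finset X) (c : C), (∀ i, (A i).card = r) ∧
        (∀ x, (∀ i, x i ∈ A i) → φ x = c) ∧
        ∀ x y, (∀ i, x i ∈ A i) → (∀ i, y i ∈ A i) → f x = f y → x = y := by
  induction e with
  | zero =>
    intro X _ φ f _
    exact ⟨fun _ => ∅, φ Fin.elim0, fun i => i.elim0, fun x _ => congrArg φ (Subsingleton.elim _ _),
      fun x y _ _ _ => Subsingleton.elim _ _⟩
  | succ e ih =>
    intro X hX φ f hf
    rw [Function.iterate_succ_apply'] at hX
    set μ := Order.succ^[e] κ with hμ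
    have hμκ : κ ≤ μ := Order.le_succ_iterate e κ
    have hμ0 : ℵ₀ ≤ μ := hκ.trans hμκ
    have hlt : μ < #X := (Order.lt_succ μ).trans_le hX
    obtain ⟨Y, hY⟩ := le_mk_iff_exists_set.1 hlt.le
    have : Infinite Y := infinite_iff.2 (by rw [hY]; exact hμ0)
    have : Infinite X := infinite_iff.2 (hμ0.trans hlt.le)
    let ext (z : X) (x : Fin e → Y) : Fin (e + 1) → X := Fin.cons z fun i => (x i : X)
    have h1 (z : X) : OneToOneEachCoord fun x => f (ext z x) := by
      rintro a b ⟨i, hi, hj⟩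
      refine hf _ _ ⟨i.succ, by simpa [ext, Subtype.ext_iff] using hi, fun j hne => ?_⟩
      refine Fin.cases (by simp [ext]) (fun j hne => ?_) j hne
      simp [ext, hj j (by simpa using hne)]
    choose A c hA hc hinj using fun z => ih Y hY.ge (fun x => φ (ext z x)) _ (h1 z)
    have hcard : #((Fin e → Finset Y) × C) < #X := by
      refine lt_of_le_of_lt ?_ hlt
      simp only [mk_prod, lift_id, mk_pi, prod_const, mk_finset_of_infinite, mk_fin]
      refine mul_le_of_le hμ0 ?_ (hC.trans hμκ)
      rw [hY]; exact power_nat_le hμ0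
    obtain ⟨⟨B, c₀⟩, hB⟩ := exists_infinite_fiber (fun z => (A z, c z)) hcard
    set Z := (fun z => (A z, c z)) ⁻¹' {(B, c₀)} with hZ
    have hZ' : Z.Infinite := Set.infinite_coe_iff.1 hB
    have hAB : ∀ z ∈ Z, A z = B ∧ c z = c₀ := fun z hz => by simpa [hZ] using hz
    have hgreedy : ∀ m : ℕ, ∃ M : Finset X, (M : Set X) ⊆ Z ∧ M.card = m ∧
        ∀ z ∈ M, ∀ z' ∈ M, ∀ a ∈ Fintype.piFinset B, ∀ b ∈ Fintype.piFinset B,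
          f (ext z a) = f (ext z' b) → z = z' := by
      intro m
      induction m with
      | zero => exact ⟨∅, by simp, rfl, by simp⟩
      | succ m ihm =>
        obtain ⟨M, hMZ, hM, hfree⟩ := ihm
        have hbad : (⋃ z ∈ M, ⋃ a ∈ Fintype.piFinset B, ⋃ b ∈ Fintype.piFinset B,
            {z' | f (ext z' b) = f (ext z a)}).Finite := by
          refine M.finite_toSet.biUnion fun z _ => (Finset.finite_toSet _).biUnion fun a _ =>
            (Finset.finite_toSet _).biUnion fun b _ => Set.Subsingleton.finite ?_
          intro z₁ h₁ z₂ h₂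
          by_contra hne
          refine hf (ext z₁ b) (ext z₂ b) ⟨0, by simpa [ext], fun j hj => ?_⟩ (h₁.trans h₂.symm)
          obtain ⟨j, rfl⟩ := Fin.exists_succ_eq.2 hj
          simp [ext]
        obtain ⟨w, ⟨hwZ, hw⟩, hwM⟩ := ((hZ'.sdiff hbad).sdiff M.finite_toSet).nonempty
        simp only [Set.mem_iUnion, not_exists, Set.mem_ofPred_eq] at hw
        have hwM' : w ∉ M := by simpa using hwM
        refine ⟨Finset.cons w M hwM', ?_, by simp [hM], ?_⟩
        · simp [Set.insert_subset_iff, hwZ, hMZ]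
        · simp only [Finset.mem_cons]
          rintro z (rfl | hz) z' (rfl | hz') a ha b hb hab
          · rfl
          · exact (hw z' hz' b hb a ha hab).elim
          · exact (hw z hz a ha b hb hab.symm).elim
          · exact hfree z hz z' hz' a ha b hb hab
    obtain ⟨M, hMZ, hM, hfree⟩ := hgreedy r
    have hlift : ∀ x : Fin (e + 1) → X,
        (∀ i, x i ∈ (Fin.cons M fun i => (B i).map (Function.Embedding.subtype _) :
          Fin (e + 1) → Finset X) i) →
        x 0 ∈ M ∧ ∃ a : Fin e → Y, (∀ i, a i ∈ B i) ∧ x = ext (x 0) a := by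
      intro x hx
      refine ⟨by simpa using hx 0, ?_⟩
      have : ∀ i : Fin e, ∃ y ∈ B i, (y : X) = x i.succ := fun i => by simpa using hx i.succ
      choose a ha hax using this
      refine ⟨a, ha, funext fun i => ?_⟩
      refine Fin.cases (by simp [ext]) (fun i => by simp [ext, hax]) i
    refine ⟨Fin.cons M fun i => (B i).map (Function.Embedding.subtype _), c₀, ?_, ?_, ?_⟩
    · intro i
      refine Fin.cases (by simpa) (fun i => ?_) i
      obtain ⟨z, hz⟩ := hZ'.nonempty
      simp [← (hAB z hz).1, hA]
    · intro x hx
      obtain ⟨h0, a, ha, hxa⟩ := hlift x hx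
      rw [hxa, ← (hAB _ (hMZ h0)).2]
      exact hc _ a (by rwa [(hAB _ (hMZ h0)).1])
    · intro x y hx hy hxy
      obtain ⟨h0, a, ha, hxa⟩ := hlift x hx
      obtain ⟨h0', b, hb, hyb⟩ := hlift y hy
      have h00 : x 0 = y 0 := hfree _ h0 _ h0' a (by simpa using ha) b (by simpa using hb)
        (by rw [← hxa, ← hyb, hxy])
      rw [hxa, hyb, ← h00] at hxy
      have hab := hinj (x 0) a b (by rwa [(hAB _ (hMZ h0)).1]) (by rwa [(hAB _ (hMZ h0)).1]) hxy
      rw [hxa, hyb, ← h00, hab]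

/-- If the coordinates in the range of `J` separate the template `P`, every coloring of `X^d` by
few colors is constant on an edge of `L(X^d, P)` on which `f` is injective. -/
theorem exists_monochromatic_edge {κ : Cardinal.{0}} (hκ : ℵ₀ ≤ κ) {C : Type} (hC : #C ≤ κ)
    {k d e : ℕ} {α X : Type} {V : Type*} [Nonempty X] (P : Finset (Fin d → α)) (hP : P.card = k)
    (J : Fin e → Fin d) (hJ : Function.Injective J)
    (hsep : ∀ x ∈ P, ∀ y ∈ P, (∀ j, x (J j) = y (J j)) → x = y)
    (hX : Order.succ^[e] κ ≤ #X) (φ : (Fin d → X) → C) (f : (Fin d → X) → V)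
    (hf : OneToOneEachCoord f) :
    ∃ Q ∈ LEdges k P X, Set.InjOn f Q ∧ ∀ x ∈ Q, ∀ y ∈ Q, φ x = φ y := by
  classical
  obtain ⟨o⟩ := ‹Nonempty X›
  have : Nonempty C := ⟨φ fun _ => o⟩
  let ext (x : Fin e → X) : Fin d → X := Function.extend J x fun _ => o
  have hext (x : Fin e → X) (j) : ext x (J j) = x j := hJ.extend_apply _ _ _
  have hext' (x : Fin e → X) (i) (hi : ¬ ∃ j, J j = i) : ext x i = o :=
    Function.extend_apply' _ _ _ hi
  have hfe : OneToOneEachCoord fun x => f (ext x) := by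
    rintro a b ⟨i, hi, hj⟩
    refine hf _ _ ⟨J i, by simpa [hext] using hi, fun j hne => ?_⟩
    by_cases hj' : ∃ j', J j' = j
    · obtain ⟨j', rfl⟩ := hj'
      rw [hext, hext, hj j' (fun h => hne (h ▸ rfl))]
    · rw [hext' _ _ hj', hext' _ _ hj']
  obtain ⟨A, c, hA, hφ, hinj⟩ := exists_monochromatic_grid hκ hC k e X hX (fun x => φ (ext x)) _ hfe
  have hemb (j : Fin e) : ∃ g : α → X, (∀ x ∈ P, g (x (J j)) ∈ A j) ∧
      ∀ x ∈ P, ∀ y ∈ P, g (x (J j)) = g (y (J j)) → x (J j) = y (J j) := by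
    obtain ⟨g, hg⟩ := Finset.exists_subset_card_eq
      (show (P.image fun x => x (J j)).card ≤ (A j).card by
        rw [hA, ← hP]; exact Finset.card_image_le)
    have eqv := Finset.equivOfCardEq hg.2.symm
    refine ⟨fun a => if h : a ∈ P.image fun x => x (J j) then (eqv ⟨a, h⟩ : X) else o,
      fun x hx => ?_, fun x hx y hy hxy => ?_⟩
    · beta_reduce
      rw [dif_pos (Finset.mem_image_of_mem _ hx)]
      exact hg.1 (eqv _).2
    · beta_reduce at hxy
      rw [dif_pos (Finset.mem_image_of_mem _ hx), dif_pos (Finset.mem_image_of_mem _ hy)] at hxy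
      simpa using eqv.injective (Subtype.ext hxy)
  choose g hgA hginj using hemb
  let G (x : Fin d → α) : Fin d → X := ext fun j => g j (x (J j))
  have hGinj : Set.InjOn (fun x => f (G x)) P := fun x hx y hy hxy => by
    have := hinj _ _ (fun j => hgA j x hx) (fun j => hgA j y hy) hxy
    exact hsep x hx y hy fun j => hginj j x hx y hy (congrFun this j)
  refine ⟨P.image G, ⟨?_, G, fun x hx => Finset.mem_image_of_mem _ hx, by simp, ?_⟩, ?_, ?_⟩
  · rw [Finset.card_image_of_injOn (fun x hx y hy hxy => hGinj hx hy (congrArg f hxy)), hP]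
  · intro x _ y _ i hi
    by_cases hj : ∃ j, J j = i
    · obtain ⟨j, rfl⟩ := hj
      simp only [G, hext, hi]
    · simp only [G, hext' _ _ hj]
  · rw [Finset.coe_image]
    rintro _ ⟨x, hx, rfl⟩ _ ⟨y, hy, rfl⟩ hxy
    rw [hGinj hx hy hxy]
  · simp only [Finset.mem_image]
    rintro _ ⟨x, hx, rfl⟩ _ ⟨y, hy, rfl⟩
    exact (hφ _ fun j => hgA j x hx).trans (hφ _ fun j => hgA j y hy).symm

theorem properlyColorable_mono {V : Type} {E : Set (Finset V)} {κ μ : Cardinal.{0}}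
    (h : ProperlyColorable E κ) (hle : κ ≤ μ) : ProperlyColorable E μ := by
  obtain ⟨C, φ, hC, hφ⟩ := h
  exact ⟨C, φ, hC.trans hle, hφ⟩

theorem chromaticNumber_le_iff {V : Type} {E : Set (Finset V)} {κ : Cardinal.{0}}
    (hE : ∀ e ∈ E, 2 ≤ e.card) : chromaticNumber E ≤ κ ↔ ProperlyColorable E κ := by
  refine ⟨fun h => ?_, fun h => csInf_le' h⟩
  have hne : {κ | ProperlyColorable E κ}.Nonempty := ⟨#V, V, id, le_rfl, fun e he => by
    obtain ⟨x, hx, y, hy, hxy⟩ := Finset.one_lt_card.1 (hE e he)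
    exact ⟨x, hx, y, hy, hxy⟩⟩
  exact properlyColorable_mono (csInf_mem hne) h

open MvPolynomial in
theorem hasDerivAt_aeval_update {F σ : Type*} [Field F] [Algebra F ℝ] [DecidableEq σ]
    (q : MvPolynomial σ F) (x : σ → ℝ) (i : σ) (y : ℝ) :
    HasDerivAt (fun y => aeval (Function.update x i y) q)
      (aeval (Function.update x i y) (pderiv i q)) y := by
  induction q using MvPolynomial.induction_on with
  | C a => simpa using hasDerivAt_const y (algebraMap F ℝ a)
  | add p q hp hq =>
    simp only [map_add]
    exact hp.add hq
  | mul_X p j hp =>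
    have hX : HasDerivAt (fun y => Function.update x i y j) ((Pi.single i 1 : σ → ℝ) j) y := by
      by_cases h : j = i
      · subst h
        simp only [Function.update_self, Pi.single_eq_same]
        exact hasDerivAt_id y
      · simpa [h] using hasDerivAt_const y (x j)
    simp only [Derivation.leibniz, pderiv_X, map_add, smul_eq_mul, map_mul, aeval_X]
    refine (hp.mul hX).congr_deriv ?_
    by_cases h : j = i
    · subst h
      simp
      ring
    · simp [h]
      ring

open MvPolynomial in
/-- Rolle's theorem for a polynomial restricted to a line parallel to a coordinate axis. -/
theorem eq_of_aeval_update_eq_zero {F σ : Type*} [Field F] [Algebra F ℝ] [DecidableEq σ]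
    (q : MvPolynomial σ F) (x : σ → ℝ) (i : σ) {y z : ℝ}
    (hy : aeval (Function.update x i y) q = 0) (hz : aeval (Function.update x i z) q = 0)
    (hd : ∀ w ∈ Set.uIcc y z, aeval (Function.update x i w) (pderiv i q) ≠ 0) : y = z := by
  wlog h : y < z generalizing y z
  · rcases (not_lt.1 h).eq_or_lt with h | h
    · exact h.symm
    · exact (this hz hy (by rwa [Set.uIcc_comm]) h).symm
  obtain ⟨w, hw, hw0⟩ := exists_hasDerivAt_eq_zero h
    (fun w _ => (hasDerivAt_aeval_update q x i w).continuousAt.continuousWithinAt)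
    (hy.trans hz.symm) fun w _ => hasDerivAt_aeval_update q x i w
  exact absurd hw0 (hd w (Set.Icc_subset_uIcc (Set.Ioo_subset_Icc_self hw)))

/-- Polynomial equations in `s` parameters and one unknown for each of `n` coordinates, together
with rational intervals confining the parameters and the unknowns. -/
structure ImplicitData (F : Type) [Field F] (s n : ℕ) where
  poly : Fin n → MvPolynomial (Option (Fin s)) F
  left : Fin s → ℚ
  right : Fin s → ℚ
  lower : Fin n → ℚ
  upper : Fin n → ℚ

namespace ImplicitData

open MvPolynomial

variable {F : Type} [Field F] {s n : ℕ}

instance [Countable F] : Countable (ImplicitData F s n) := by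
  have : Function.Injective fun D : ImplicitData F s n =>
      (D.poly, D.left, D.right, D.lower, D.upper) := by
    rintro ⟨⟩ ⟨⟩ h
    simpa using h
  have : Countable (MvPolynomial (Option (Fin s)) F) := by
    rw [← Cardinal.mk_le_aleph0_iff]
    exact MvPolynomial.cardinalMk_le_max.trans (by simp)
  exact Function.Injective.countable ‹Function.Injective _›

/-- The open box of parameters. -/
def box (D : ImplicitData F s n) : Set (Fin s → ℝ) :=
  {t | ∀ i, t i ∈ Set.Ioo (D.left i : ℝ) (D.right i)}

/-- The interval of values of the unknown with index `c`. -/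
def range (D : ImplicitData F s n) (c : Fin n) : Set ℝ := Set.Icc (D.lower c : ℝ) (D.upper c)

/-- The point with parameters `t` and unknown `y`. -/
def point (t : Fin s → ℝ) (y : ℝ) : Option (Fin s) → ℝ := fun o => o.elim y t

@[simp] theorem point_none (t : Fin s → ℝ) (y : ℝ) : point t y none = y := rfl

@[simp] theorem point_some (t : Fin s → ℝ) (y : ℝ) (i : Fin s) : point t y (some i) = t i := rfl

theorem update_point_none (t : Fin s → ℝ) (y z : ℝ) :
    Function.update (point t y) none z = point t z := by
  ext (_ | i) <;> simp

theorem update_point_some (t : Fin s → ℝ) (y z : ℝ) (i : Fin s) :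
    Function.update (point t y) (some i) z = point (Function.update t i z) y := by
  ext (_ | j)
  · simp
  · by_cases h : j = i
    · subst h
      simp
    · simp [h]

theorem isOpen_box (D : ImplicitData F s n) : IsOpen D.box := by
  have : D.box = Set.univ.pi fun i => Set.Ioo (D.left i : ℝ) (D.right i) := by
    ext
    simp [box, Set.mem_pi]
  rw [this]
  exact isOpen_set_pi Set.finite_univ fun i _ => isOpen_Ioo

variable [Algebra F ℝ]

/-- The conditions under which each equation has exactly one solution, which depends injectively
on every single parameter. -/
structure Valid (D : ImplicitData F s n) : Prop where
  disjoint : ∀ i j, ∀ r ∈ Set.Ioo (D.left i : ℝ) (D.right i),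
    r ∈ Set.Ioo (D.left j : ℝ) (D.right j) → i = j
  lower_le : ∀ c, (D.lower c : ℝ) ≤ D.upper c
  sign : ∀ c, ∀ t ∈ D.box,
    aeval (point t (D.lower c)) (D.poly c) * aeval (point t (D.upper c)) (D.poly c) < 0
  deriv_unknown : ∀ c, ∀ t ∈ D.box, ∀ y ∈ D.range c,
    aeval (point t y) (pderiv none (D.poly c)) ≠ 0
  deriv_param : ∀ i, ∃ c, ∀ t ∈ D.box, ∀ y ∈ D.range c,
    aeval (point t y) (pderiv (some i) (D.poly c)) ≠ 0

open Classical in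
/-- The solution of the system with the given parameters. -/
noncomputable def sol (D : ImplicitData F s n) (t : Fin s → ℝ) (c : Fin n) : ℝ :=
  if h : ∃ y ∈ D.range c, aeval (point t y) (D.poly c) = 0 then h.choose else 0

namespace Valid

variable {D : ImplicitData F s n} {t : Fin s → ℝ}

theorem exists_root (hD : D.Valid) (ht : t ∈ D.box) (c : Fin n) :
    ∃ y ∈ D.range c, aeval (point t y) (D.poly c) = 0 := by
  have hcont : ContinuousOn (fun y => aeval (point t y) (D.poly c)) (D.range c) := fun y _ => by
    have := (hasDerivAt_aeval_update (D.poly c) (point t 0) none y).continuousAt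
    simp only [update_point_none] at this
    exact this.continuousWithinAt
  rcases mul_neg_iff.1 (hD.sign c t ht) with ⟨h1, h2⟩ | ⟨h1, h2⟩
  · exact intermediate_value_Icc' (hD.lower_le c) hcont ⟨h2.le, h1.le⟩
  · exact intermediate_value_Icc (hD.lower_le c) hcont ⟨h1.le, h2.le⟩

theorem sol_mem (hD : D.Valid) (ht : t ∈ D.box) (c : Fin n) : D.sol t c ∈ D.range c := by
  rw [sol, dif_pos (hD.exists_root ht c)]
  exact (hD.exists_root ht c).choose_spec.1

theorem aeval_sol (hD : D.Valid) (ht : t ∈ D.box) (c : Fin n) :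
    aeval (point t (D.sol t c)) (D.poly c) = 0 := by
  rw [sol, dif_pos (hD.exists_root ht c)]
  exact (hD.exists_root ht c).choose_spec.2

theorem eq_sol (hD : D.Valid) (ht : t ∈ D.box) {c : Fin n} {y : ℝ} (hy : y ∈ D.range c)
    (h : aeval (point t y) (D.poly c) = 0) : y = D.sol t c := by
  refine eq_of_aeval_update_eq_zero (D.poly c) (point t 0) none ?_ ?_ fun w hw => ?_
  · rwa [update_point_none]
  · rw [update_point_none]
    exact hD.aeval_sol ht c
  · rw [update_point_none]
    exact hD.deriv_unknown c t ht w (Set.uIcc_subset_Icc hy (hD.sol_mem ht c) hw)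

theorem sol_mem_Ioo (hD : D.Valid) (ht : t ∈ D.box) (c : Fin n) :
    D.sol t c ∈ Set.Ioo (D.lower c : ℝ) (D.upper c) := by
  have h := hD.sol_mem ht c
  have h0 := hD.aeval_sol ht c
  have hs := hD.sign c t ht
  refine ⟨h.1.lt_of_ne fun he => ?_, h.2.lt_of_ne fun he => ?_⟩
  · rw [he, h0, zero_mul] at hs
    exact lt_irrefl _ hs
  · rw [← he, h0, mul_zero] at hs
    exact lt_irrefl _ hs

theorem sol_ne (hD : D.Valid) {a b : Fin s → ℝ} (ha : a ∈ D.box) (hb : b ∈ D.box)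
    {i : Fin s} (hi : a i ≠ b i)
    (hj : ∀ j, j ≠ i → a j = b j) : D.sol a ≠ D.sol b := by
  intro heq
  obtain ⟨c, hc⟩ := hD.deriv_param i
  have hab : Function.update a i (b i) = b := by
    ext j
    by_cases h : j = i
    · subst h
      simp
    · simp [h, hj j h]
  refine hi (eq_of_aeval_update_eq_zero (D.poly c) (point a (D.sol a c)) (some i) ?_ ?_
    fun w hw => ?_)
  · rw [update_point_some, Function.update_eq_self]
    exact hD.aeval_sol ha c
  · rw [update_point_some, hab, heq]
    exact hD.aeval_sol hb c
  · rw [update_point_some]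
    refine hc _ (fun j => ?_) _ (hD.sol_mem ha c)
    by_cases h : j = i
    · subst h
      rw [Function.update_self]
      exact Set.ordConnected_Ioo.uIcc_subset (ha j) (hb j) hw
    · rw [Function.update_of_ne h]
      exact ha j

end Valid

open scoped ContDiff Topology in
theorem Valid.analyticAt_sol {D : ImplicitData F s n} (hD : D.Valid) {t : Fin s → ℝ}
    (ht : t ∈ D.box) (c : Fin n) : AnalyticAt ℝ (fun t => D.sol t c) t := by
  let u : (Fin s → ℝ) × ℝ := (t, D.sol t c)
  let g : (Fin s → ℝ) × ℝ → ℝ := fun w => aeval (point w.1 w.2) (D.poly c)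
  have hg : ContDiff ℝ ω g := by
    have : g = fun w => eval (point w.1 w.2) (map (algebraMap F ℝ) (D.poly c)) := by
      ext w
      simp only [g, aeval_def, eval_map]
    rw [this]
    refine contDiff_iff_contDiffAt.2 fun w => AnalyticAt.contDiffAt ?_
    have := AnalyticAt.aeval_mvPolynomial (𝕜 := ℝ) (A := ℝ) (B := ℝ)
      (f := fun w : (Fin s → ℝ) × ℝ => point w.1 w.2) (z := w) (fun o => ?_)
      (map (algebraMap F ℝ) (D.poly c))
    · simpa only [aeval_eq_eval] using this
    · cases o with
      | none => exact analyticAt_snd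
      | some i =>
        exact ((ContinuousLinearMap.proj (R := ℝ) (φ := fun _ : Fin s => ℝ) i).comp
          (ContinuousLinearMap.fst ℝ (Fin s → ℝ) ℝ)).analyticAt w
  have hne : (ω : WithTop ℕ∞) ≠ 0 := by simp
  have hder : (fderiv ℝ g u ∘L .inr ℝ (Fin s → ℝ) ℝ) 1 ≠ 0 := by
    have h1 : HasFDerivAt g (fderiv ℝ g u) u := (hg.differentiable hne u).hasFDerivAt
    have h2 : HasDerivAt (fun y : ℝ => (t, y)) ((0 : Fin s → ℝ), (1 : ℝ)) (D.sol t c) :=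
      (hasDerivAt_const _ t).prodMk (hasDerivAt_id _)
    have h3 := h1.comp_hasDerivAt (D.sol t c) h2
    have h4 := hasDerivAt_aeval_update (D.poly c) (point t 0) none (D.sol t c)
    simp only [update_point_none] at h4
    have h5 := h3.unique h4
    have h6 := hD.deriv_unknown c t ht _ (hD.sol_mem ht c)
    rw [← h5] at h6
    simpa using h6
  have hinv : (fderiv ℝ g u ∘L .inr ℝ (Fin s → ℝ) ℝ).IsInvertible := by
    refine ⟨ContinuousLinearEquiv.unitsEquivAut ℝ (Units.mk0 _ hder), ?_⟩
    ext
    simp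
  have hcd : ContDiffAt ℝ ω g u := hg.contDiffAt
  have hψ := hcd.contDiffAt_implicitFunction hne hinv
  have hψ0 := hcd.implicitFunction_apply_self hne hinv
  have hψe := hcd.eventually_apply_implicitFunction hne hinv
  set ψ := hcd.implicitFunction hne hinv
  refine hψ.analyticAt.congr ?_
  have hmem : ∀ᶠ x in 𝓝 t, ψ x ∈ Set.Ioo (D.lower c : ℝ) (D.upper c) :=
    hψ.continuousAt.eventually_mem (isOpen_Ioo.mem_nhds (by
      rw [hψ0]
      exact hD.sol_mem_Ioo ht c))
  filter_upwards [hψe, hmem, D.isOpen_box.mem_nhds ht] with x h1 h2 h3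
  refine hD.eq_sol h3 (Set.Ioo_subset_Icc_self h2) ?_
  exact h1.trans (hD.aeval_sol ht c)

end ImplicitData

open MvPolynomial in
/-- An analytic function on a domain which is algebraic over the polynomials with coefficients in
`F` and vanishes at a point with algebraically independent coordinates vanishes identically. -/
theorem eqOn_zero_of_algebraicIndependent {F : Type*} [Field F] [Algebra F ℝ] {Θ : Type*}
    [Fintype Θ] {U : Set (Θ → ℝ)} (hUo : IsOpen U) (hU : IsPreconnected U) {G : (Θ → ℝ) → ℝ}
    (hG : AnalyticOnNhd ℝ G U) {R : Polynomial (MvPolynomial Θ F)} (hR : R ≠ 0)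
    (hRG : ∀ τ ∈ U, R.eval₂ (aeval τ : MvPolynomial Θ F →ₐ[F] ℝ).toRingHom (G τ) = 0)
    {τ₀ : Θ → ℝ} (hτ₀ : τ₀ ∈ U) (hind : AlgebraicIndependent F τ₀) (h0 : G τ₀ = 0) :
    Set.EqOn G 0 U := by
  intro z hz
  by_contra hGz
  obtain ⟨R', hR', hdvd⟩ := R.exists_eq_pow_rootMultiplicity_mul_and_not_dvd hR 0
  rw [Polynomial.C_0, sub_zero, Polynomial.X_dvd_iff] at hdvd
  rw [Polynomial.C_0, sub_zero] at hR'
  let H : (Θ → ℝ) → ℝ := fun τ =>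
    R'.eval₂ (aeval τ : MvPolynomial Θ F →ₐ[F] ℝ).toRingHom (G τ)
  have hH : AnalyticOnNhd ℝ H U := by
    intro τ hτ
    have : H = fun τ => ∑ j ∈ R'.support, aeval τ (R'.coeff j) * G τ ^ j := by
      ext τ
      simp [H, Polynomial.eval₂_eq_sum, Polynomial.sum]
    rw [this]
    refine Finset.analyticAt_fun_sum _ fun j _ => AnalyticAt.mul ?_ ((hG τ hτ).pow j)
    have h2 : (fun τ : Θ → ℝ => aeval τ (R'.coeff j)) =
        fun τ => eval τ (map (algebraMap F ℝ) (R'.coeff j)) := by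
      ext τ
      rw [aeval_def, eval_map]
    rw [h2]
    exact AnalyticOnNhd.eval_mvPolynomial _ τ trivial
  have hHz : H =ᶠ[nhds z] 0 := by
    filter_upwards [hUo.mem_nhds hz, (hG z hz).continuousAt.eventually_ne hGz] with τ hτ hne
    have := hRG τ hτ
    rw [hR', Polynomial.eval₂_mul, Polynomial.eval₂_pow, Polynomial.eval₂_X] at this
    exact (mul_eq_zero.1 this).resolve_left (pow_ne_zero _ hne)
  have hH0 := hH.eqOn_zero_of_preconnected_of_eventuallyEq_zero hU hz hHz hτ₀
  simp only [H, h0, Pi.zero_apply, Polynomial.eval₂_at_zero] at hH0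
  exact hdvd (hind (by simpa using hH0))

open MvPolynomial in
/-- Functions algebraic over the polynomial functions are closed under polynomial operations. -/
theorem exists_eval₂_aeval_eq_zero {F : Type*} [Field F] [Algebra F ℝ] {Θ ι : Type*}
    {U : Set (Θ → ℝ)} {g : ι → (Θ → ℝ) → ℝ}
    (hg : ∀ v, ∃ Q : Polynomial (MvPolynomial Θ F), Q ≠ 0 ∧ ∀ τ ∈ U,
      Q.eval₂ (aeval τ : MvPolynomial Θ F →ₐ[F] ℝ).toRingHom (g v τ) = 0)
    (p : MvPolynomial ι F) :
    ∃ R : Polynomial (MvPolynomial Θ F), R ≠ 0 ∧ ∀ τ ∈ U,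
      R.eval₂ (aeval τ : MvPolynomial Θ F →ₐ[F] ℝ).toRingHom (aeval (fun v => g v τ) p) = 0 := by
  let φ : MvPolynomial Θ F →ₐ[F] (U → ℝ) := aeval fun θ τ => τ.1 θ
  let : Algebra (MvPolynomial Θ F) (U → ℝ) := φ.toRingHom.toAlgebra
  have hcomp (τ : U) : (Pi.evalRingHom (fun _ : U => ℝ) τ).comp
      (algebraMap (MvPolynomial Θ F) (U → ℝ)) =
      (aeval τ.1 : MvPolynomial Θ F →ₐ[F] ℝ).toRingHom := by
    have : (Pi.evalAlgHom F (fun _ : U => ℝ) τ).comp φ = aeval τ.1 := by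
      ext θ
      simp [φ]
    exact congrArg AlgHom.toRingHom this
  have heval (R : Polynomial (MvPolynomial Θ F)) (h : U → ℝ) (τ : U) : Polynomial.aeval h R τ =
      R.eval₂ (aeval τ.1 : MvPolynomial Θ F →ₐ[F] ℝ).toRingHom (h τ) := by
    rw [← hcomp]
    exact Polynomial.hom_eval₂ _ _ (Pi.evalRingHom (fun _ : U => ℝ) τ) _
  have hgalg (v) : IsAlgebraic (MvPolynomial Θ F) (fun τ : U => g v τ) := by
    obtain ⟨Q, hQ, h⟩ := hg v
    exact ⟨Q, hQ, funext fun τ => (heval Q _ τ).trans (h τ τ.2)⟩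
  have hp : IsAlgebraic (MvPolynomial Θ F) (fun τ : U => aeval (fun v => g v τ) p) := by
    induction p using MvPolynomial.induction_on with
    | C a =>
      convert isAlgebraic_algebraMap (R := MvPolynomial Θ F) (A := U → ℝ) (C a) using 1
      ext τ
      have := congrFun (congrArg DFunLike.coe (hcomp τ)) (C a)
      simp only [RingHom.comp_apply, Pi.evalRingHom_apply] at this
      rw [this]
      simp
    | add p q hp hq =>
      simp only [map_add]
      exact hp.add hq
    | mul_X p v hp =>
      simp only [map_mul, aeval_X]
      exact hp.mul (hgalg v)
  obtain ⟨R, hR, h⟩ := hp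
  exact ⟨R, hR, fun τ hτ => (heval R _ ⟨τ, hτ⟩).symm.trans (congrFun h ⟨τ, hτ⟩)⟩

namespace ImplicitData

open MvPolynomial

variable {F : Type} [Field F] [Algebra F ℝ] {s n : ℕ}

/-- A polynomial relation over `F` between solutions of a valid system persists when the parameters,
taken from an algebraically independent set, are moved inside the box. -/
theorem Valid.aeval_eq_zero {D : ImplicitData F s n} (hD : D.Valid) {k : ℕ}
    {p : MvPolynomial (Fin k × Fin n) F} {T : Set ℝ}
    (hT : AlgebraicIndependent F ((↑) : T → ℝ)) {S : Fin k → Fin s → ℝ}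
    (hS : ∀ l, S l ∈ D.box) (hST : ∀ l i, S l i ∈ T)
    (h0 : aeval (fun v => D.sol (S v.1) v.2) p = 0) {x : Fin k → Fin s → ℝ}
    (hx : ∀ l, x l ∈ D.box) (hxS : ∀ l l' i, S l i = S l' i → x l i = x l' i) :
    aeval (fun v => D.sol (x v.1) v.2) p = 0 := by
  classical
  let Θ : Type := Set.range fun v : Fin k × Fin s => S v.1 v.2
  have : Fintype Θ := inferInstanceAs (Fintype (Set.range fun v : Fin k × Fin s => S v.1 v.2))
  choose w hw using fun θ : Θ => θ.2
  let mk (l : Fin k) (i : Fin s) : Θ := ⟨S l i, (l, i), rfl⟩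
  have hmk (l i) : S (w (mk l i)).1 (w (mk l i)).2 = S l i := hw (mk l i)
  have hidx (l i) : (w (mk l i)).2 = i :=
    hD.disjoint _ _ _ (hS _ _) (by rw [hmk]; exact hS l i)
  let U : Set (Θ → ℝ) := Set.univ.pi fun θ =>
    Set.Ioo (D.left (w θ).2 : ℝ) (D.right (w θ).2)
  have hUo : IsOpen U := isOpen_set_pi Set.finite_univ fun i _ => isOpen_Ioo
  have hUc : IsPreconnected U := (convex_pi fun i _ => convex_Ioo _ _).isPreconnected
  have hid : ((↑) : Θ → ℝ) ∈ U := fun θ _ => by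
    rw [← hw θ]
    exact hS _ _
  let X (l : Fin k) (τ : Θ → ℝ) : Fin s → ℝ := fun i => τ (mk l i)
  have hX (l) (τ) (hτ : τ ∈ U) : X l τ ∈ D.box := fun i => by
    have := hτ (mk l i) trivial
    beta_reduce at this
    rwa [hidx] at this
  let g (v : Fin k × Fin n) (τ : Θ → ℝ) : ℝ := D.sol (X v.1 τ) v.2
  have hg (v) : AnalyticOnNhd ℝ (g v) U := fun τ hτ => by
    refine AnalyticAt.comp (f := X v.1) (hD.analyticAt_sol (hX v.1 τ hτ) v.2) ?_
    exact (ContinuousLinearMap.pi fun i =>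
      ContinuousLinearMap.proj (R := ℝ) (φ := fun _ : Θ => ℝ) (mk v.1 i)).analyticAt τ
  let G (τ : Θ → ℝ) : ℝ := aeval (fun v => g v τ) p
  have hG : AnalyticOnNhd ℝ G U := fun τ hτ => by
    have : G = fun τ => aeval (fun v => g v τ) (map (algebraMap F ℝ) p) := by
      ext τ
      simp [G, aeval_map_algebraMap]
    rw [this]
    exact AnalyticAt.aeval_mvPolynomial (fun v => hg v τ hτ) _
  obtain ⟨R, hR, hRG⟩ := exists_eval₂_aeval_eq_zero (F := F) (U := U) (g := g) (fun v => by
    let Q : Polynomial (MvPolynomial Θ F) := aeval (fun o : Option (Fin s) =>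
      o.elim Polynomial.X fun i => Polynomial.C (MvPolynomial.X (mk v.1 i))) (D.poly v.2)
    have hQ (τ : Θ → ℝ) (y : ℝ) : Q.eval₂ (aeval τ : MvPolynomial Θ F →ₐ[F] ℝ).toRingHom y =
        aeval (point (X v.1 τ) y) (D.poly v.2) := by
      have : (Polynomial.eval₂RingHom (aeval τ : MvPolynomial Θ F →ₐ[F] ℝ).toRingHom y).comp
          (aeval (fun o : Option (Fin s) => o.elim Polynomial.X fun i =>
            Polynomial.C (MvPolynomial.X (mk v.1 i)))).toRingHom =
          (aeval (point (X v.1 τ) y) : MvPolynomial (Option (Fin s)) F →ₐ[F] ℝ).toRingHom := by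
        refine MvPolynomial.ringHom_ext (fun a => ?_) ?_
        · simp [MvPolynomial.algebraMap_eq]
        · rintro (_ | i) <;> simp [X]
      exact congrFun (congrArg DFunLike.coe this) (D.poly v.2)
    refine ⟨Q, fun h => ?_, fun τ hτ => (hQ τ _).trans (hD.aeval_sol (hX v.1 τ hτ) v.2)⟩
    have := hD.sign v.2 _ (hX v.1 _ hid)
    rw [← hQ, h, Polynomial.eval₂_zero, zero_mul] at this
    exact lt_irrefl _ this) p
  have hzero := eqOn_zero_of_algebraicIndependent hUo hUc hG hR
    hRG hid
    (hT.mono (by rintro _ ⟨v, rfl⟩; exact hST _ _)) h0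
  have hτ : (fun θ => x (w θ).1 (w θ).2) ∈ U := fun θ _ => hx _ _
  have hXx (l) : X l (fun θ => x (w θ).1 (w θ).2) = x l := by
    ext i
    have := hxS (w (mk l i)).1 l i (by rw [← hmk l i, hidx])
    simp only [X, hidx, this]
  have := hzero hτ
  simpa only [G, g, hXx, Pi.zero_apply] using this

end ImplicitData

namespace MvPolynomial

theorem totalDegree_pderiv_lt {σ R : Type*} [CommSemiring R] {i : σ} {p : MvPolynomial σ R}
    (h : pderiv i p ≠ 0) : (pderiv i p).totalDegree < p.totalDegree := by
  have key : ∀ m ∈ (pderiv i p).support, (m.sum fun _ e => e) + 1 ≤ p.totalDegree := by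
    intro m hm
    rw [mem_support_iff, coeff_pderiv] at hm
    have := le_totalDegree (mem_support_iff.2 (left_ne_zero_of_mul hm))
    rwa [Finsupp.sum_add_index' (fun _ => rfl) (fun _ _ _ => rfl),
      Finsupp.sum_single_index rfl] at this
  obtain ⟨m, hm⟩ := support_nonempty.2 h
  have h1 : (pderiv i p).totalDegree ≤ p.totalDegree - 1 :=
    Finset.sup_le fun m hm => Nat.le_sub_one_of_lt (key m hm)
  have := key m hm
  omega

theorem notMem_vars_of_pderiv_eq_zero {σ R : Type*} [Field R] [CharZero R] {i : σ}
    {p : MvPolynomial σ R} (h : pderiv i p = 0) : i ∉ p.vars := by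
  intro hi
  obtain ⟨m, hm, hmi⟩ := (mem_vars_iff_mem_support i).1 hi
  have := congrArg (coeff (m - Finsupp.single i 1)) h
  rw [coeff_pderiv, coeff_zero, tsub_add_cancel_of_le] at this
  · rcases mul_eq_zero.1 this with h | h
    · exact mem_support_iff.1 hm h
    · exact Nat.cast_add_one_ne_zero _ h
  · rw [Finsupp.single_le_iff]
    exact Nat.one_le_iff_ne_zero.2 (Finsupp.mem_support_iff.1 hmi)

/-- A nonzero relation of least degree is not satisfied together with one of its nonzero partial
derivatives. -/
theorem exists_relation_pderiv {σ R A : Type*} [Field R] [CommRing A] [Algebra R A] {x : σ → A}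
    (h : ∃ q : MvPolynomial σ R, q ≠ 0 ∧ aeval x q = 0) :
    ∃ q : MvPolynomial σ R, q ≠ 0 ∧ aeval x q = 0 ∧
      ∀ i, aeval x (pderiv i q) = 0 → pderiv i q = 0 := by
  obtain ⟨q, ⟨hq, hq0⟩, hmin⟩ := exists_minimalFor_of_wellFoundedLT
    (fun q : MvPolynomial σ R => q ≠ 0 ∧ aeval x q = 0) totalDegree h
  refine ⟨q, hq, hq0, fun i hi => ?_⟩
  by_contra hne
  exact absurd (hmin ⟨hne, hi⟩ (totalDegree_pderiv_lt hne).le) (totalDegree_pderiv_lt hne).not_ge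

end MvPolynomial

open MvPolynomial in
/-- Every tuple of reals is algebraically dependent on finitely many elements of a transcendence
basis. -/
theorem exists_fin_relation {F : Type*} [Field F] [Algebra F ℝ] {T : Set ℝ}
    (hT : IsTranscendenceBasis F ((↑) : T → ℝ)) {n : ℕ} (a : Fin n → ℝ) :
    ∃ (s : ℕ) (S : Fin s → T), Function.Injective S ∧
      ∀ c, ∃ q : MvPolynomial (Option (Fin s)) F, q ≠ 0 ∧
        aeval (ImplicitData.point (fun i => (S i : ℝ)) (a c)) q = 0 := by
  classical
  have h (c) : ∃ q : MvPolynomial (Option T) F, q ≠ 0 ∧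
      aeval (fun o : Option T => o.elim (a c) (↑)) q = 0 := by
    have hna : ¬ AlgebraicIndependent F (fun o : Option T => o.elim (a c) ((↑) : T → ℝ)) := by
      rw [hT.1.option_iff_transcendental]
      exact not_not.2 (hT.isAlgebraic.isAlgebraic _)
    rw [algebraicIndependent_iff] at hna
    push Not at hna
    obtain ⟨q, hq, hq0⟩ := hna
    exact ⟨q, hq0, hq⟩
  choose q hq hq0 using h
  let Z : Finset T := Finset.univ.biUnion fun c => (q c).vars.preimage some
    (Option.some_injective _).injOn
  let S : Fin Z.card → T := fun i => (Z.equivFin.symm i : T)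
  have hS : Function.Injective S := Subtype.val_injective.comp (Equiv.injective _)
  refine ⟨_, S, hS, fun c => ?_⟩
  obtain ⟨r, hr⟩ := exists_rename_eq_of_vars_subset_range (q c) (Option.map S)
    (Option.map_injective hS) (by
      rintro (_ | t) ht
      · exact ⟨none, rfl⟩
      · have : t ∈ Z := Finset.mem_biUnion.2 ⟨c, Finset.mem_univ _, by simpa using ht⟩
        exact ⟨some (Z.equivFin ⟨t, this⟩), by simp [S]⟩)
  refine ⟨r, fun h => hq c (by rw [← hr, h, map_zero]), ?_⟩
  rw [← hq0 c, ← hr, aeval_rename]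
  congr 2
  ext (_ | i) <;> rfl

open MvPolynomial in
/-- Relations as in `exists_fin_relation` can be chosen nonsingular in the unknowns and, for each
parameter, in that parameter for some index. -/
theorem exists_fin_relation_pderiv {F : Type*} [Field F] [CharZero F] [Algebra F ℝ] {T : Set ℝ}
    (hT : IsTranscendenceBasis F ((↑) : T → ℝ)) {n : ℕ} (a : Fin n → ℝ) :
    ∃ (s : ℕ) (S : Fin s → ℝ) (q : Fin n → MvPolynomial (Option (Fin s)) F),
      Function.Injective S ∧ (∀ i, S i ∈ T) ∧
      (∀ c, aeval (ImplicitData.point S (a c)) (q c) = 0) ∧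
      (∀ c, aeval (ImplicitData.point S (a c)) (pderiv none (q c)) ≠ 0) ∧
      ∀ i, ∃ c, aeval (ImplicitData.point S (a c)) (pderiv (some i) (q c)) ≠ 0 := by
  classical
  have hex := exists_fin_relation hT a
  obtain ⟨S, hS, h⟩ := Nat.find_spec hex
  have hmin := fun m => Nat.find_min (m := m) hex
  generalize Nat.find hex = s at S hmin
  choose q hq hq0 hqd using fun c => exists_relation_pderiv (h c)
  refine ⟨s, fun i => S i, q, Subtype.val_injective.comp hS, fun i => (S i).2, hq0,
    fun c h0 => ?_, fun i => ?_⟩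
  · have hvars := notMem_vars_of_pderiv_eq_zero (hqd c none h0)
    obtain ⟨r, hr⟩ := exists_rename_eq_of_vars_subset_range (q c) some
      (Option.some_injective _) (by
        rintro (_ | i) hi
        · exact absurd hi hvars
        · exact ⟨i, rfl⟩)
    have := hq0 c
    rw [← hr, aeval_rename] at this
    exact hq c (by rw [← hr, (hT.1.comp S hS).eq_zero_of_aeval_eq_zero _ this, map_zero])
  · by_contra! hi
    have hvars (c) := notMem_vars_of_pderiv_eq_zero (hqd c (some i) (hi c))
    obtain _ | s := s
    · exact i.elim0
    refine hmin s (Nat.lt_succ_self s) ⟨fun j => S (i.succAbove j),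
      hS.comp Fin.succAbove_right_injective, fun c => ?_⟩
    obtain ⟨r, hr⟩ := exists_rename_eq_of_vars_subset_range (q c) (Option.map i.succAbove)
      (Option.map_injective Fin.succAbove_right_injective) (by
        rintro (_ | j) hj
        · exact ⟨none, rfl⟩
        · obtain ⟨j', hj'⟩ := Fin.exists_succAbove_eq (x := j) (y := i)
            (fun h => hvars c (h ▸ hj))
          exact ⟨some j', congrArg some hj'⟩)
    refine ⟨r, fun h => hq c (by rw [← hr, h, map_zero]), ?_⟩
    rw [← hq0 c, ← hr, aeval_rename]
    congr 2
    ext (_ | i) <;> rfl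

open Filter Topology in
theorem eventually_forall_of_eventually_nhds {ι : Type*} [Fintype ι] {S : ι → ℝ}
    {P : (ι → ℝ) → Prop} (h : ∀ᶠ t in 𝓝 S, P t) :
    ∀ᶠ δ in 𝓝[>] (0 : ℝ), ∀ t, (∀ i, |t i - S i| < δ) → P t := by
  obtain ⟨ε, hε, h⟩ := Metric.eventually_nhds_iff.1 h
  filter_upwards [Ioo_mem_nhdsGT hε] with δ hδ t ht
  refine h ((dist_pi_lt_iff hε).2 fun i => ?_)
  rw [Real.dist_eq]
  exact (ht i).trans hδ.2

open MvPolynomial in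
theorem continuous_aeval_mvPolynomial {F σ : Type*} [Field F] [Algebra F ℝ]
    (q : MvPolynomial σ F) : Continuous fun x : σ → ℝ => aeval x q := by
  have : (fun x : σ → ℝ => aeval x q) = fun x => eval x (map (algebraMap F ℝ) q) := by
    ext x
    rw [aeval_def, eval_map]
  rw [this]
  exact continuous_eval _

open Filter Topology in
/-- A function with a simple zero has opposite signs at suitable rational points on both sides. -/
theorem exists_rat_sign_change {g : ℝ → ℝ} {a d ε : ℝ} (hg : HasDerivAt g d a) (hd : d ≠ 0)
    (h0 : g a = 0) (hε : 0 < ε) :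
    ∃ l h : ℚ, a - ε < l ∧ (l : ℝ) < a ∧ a < h ∧ (h : ℝ) < a + ε ∧ g l * g h < 0 := by
  have hs : ∀ᶠ y in 𝓝[≠] a, 0 < slope g a y * d :=
    ((hasDerivAt_iff_tendsto_slope.1 hg).mul_const d).eventually_const_lt
      (mul_self_pos.2 hd)
  obtain ⟨η, hη, hs⟩ := Metric.eventually_nhds_iff.1 (eventually_nhdsWithin_iff.1 hs)
  obtain ⟨l, hl1, hl2⟩ := exists_rat_btwn (show a - min ε η < a by
    have := lt_min hε hη; linarith)
  obtain ⟨h, hh1, hh2⟩ := exists_rat_btwn (show a < a + min ε η by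
    have := lt_min hε hη; linarith)
  have hmε := min_le_left ε η
  have hmη := min_le_right ε η
  refine ⟨l, h, by linarith, hl2, hh1, by linarith, ?_⟩
  have h1 := hs (y := l) (by rw [Real.dist_eq, abs_lt]; constructor <;> linarith) hl2.ne
  have h2 := hs (y := h) (by rw [Real.dist_eq, abs_lt]; constructor <;> linarith) hh1.ne'
  rw [slope_def_field, h0, sub_zero] at h1 h2
  have h3 := mul_pos h1 h2
  have h4 : g l / (l - a) * d * (g h / (h - a) * d) =
      g l * g h * (d * d / ((l - a) * (h - a))) := by
    field_simp
  rw [h4] at h3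
  have h5 : d * d / ((l - a) * (h - a)) < 0 :=
    div_neg_of_pos_of_neg (mul_self_pos.2 hd) (mul_neg_of_neg_of_pos (by linarith) (by linarith))
  exact neg_of_mul_pos_left h3 h5.le

open MvPolynomial Filter Topology in
/-- Every tuple of reals solves a valid system with parameters in a given transcendence basis. -/
theorem ImplicitData.exists_valid {F : Type} [Field F] [CharZero F] [Algebra F ℝ] {T : Set ℝ}
    (hT : IsTranscendenceBasis F ((↑) : T → ℝ)) {n : ℕ} (a : Fin n → ℝ) :
    ∃ (s : ℕ) (D : ImplicitData F s n) (S : Fin s → ℝ),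
      D.Valid ∧ S ∈ D.box ∧ (∀ i, S i ∈ T) ∧ D.sol S = a := by
  obtain ⟨s, S, q, hinj, hST, hq0, hqy, hqt⟩ := exists_fin_relation_pderiv hT a
  choose γ hγ using hqt
  have hcont (o : Option (Fin s)) (c : Fin n)
      (h : aeval (point S (a c)) (pderiv o (q c)) ≠ 0) :
      ∀ᶠ ε in 𝓝[>] (0 : ℝ), ∀ t y, (∀ i, |t i - S i| < ε) → |y - a c| < ε →
        aeval (point t y) (pderiv o (q c)) ≠ 0 := by
    have h1 : ∀ᶠ w in 𝓝 (point S (a c)), aeval w (pderiv o (q c)) ≠ 0 :=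
      (continuous_aeval_mvPolynomial _).continuousAt.eventually_ne h
    filter_upwards [eventually_forall_of_eventually_nhds h1] with ε hε t y ht hy
    refine hε _ ?_
    rintro (_ | i)
    · exact hy
    · exact ht i
  obtain ⟨ε, ⟨hεy, hεt⟩, hε⟩ := (((eventually_all.2 fun c => hcont none c (hqy c)).and
    (eventually_all.2 fun i => hcont (some i) (γ i) (hγ i))).and self_mem_nhdsWithin).exists
  replace hε : 0 < ε := hε
  have hsign (c) : ∃ l h : ℚ, a c - ε < l ∧ (l : ℝ) < a c ∧ a c < h ∧ (h : ℝ) < a c + ε ∧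
      aeval (point S l) (q c) * aeval (point S h) (q c) < 0 := by
    have hd := hasDerivAt_aeval_update (q c) (point S 0) none (a c)
    simp only [update_point_none] at hd
    exact exists_rat_sign_change hd (hqy c) (hq0 c) hε
  choose l h hl1 hl2 hh1 hh2 hlh using hsign
  have hsign' (c) : ∀ᶠ t in 𝓝 S,
      aeval (point t (l c)) (q c) * aeval (point t (h c)) (q c) < 0 := by
    have hp (y : ℝ) : Continuous fun t : Fin s → ℝ => aeval (point t y) (q c) := by
      refine (continuous_aeval_mvPolynomial _).comp (continuous_pi ?_)
      rintro (_ | i)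
      · exact continuous_const
      · exact continuous_apply i
    exact ((hp _).mul (hp _)).continuousAt.eventually_lt_const (hlh c)
  have hdisj (i j : Fin s) : ∀ᶠ δ in 𝓝[>] (0 : ℝ), i ≠ j → 2 * δ < |S i - S j| := by
    by_cases hij : i = j
    · simp [hij]
    · have : 0 < |S i - S j| / 2 := by
        have := abs_pos.2 (sub_ne_zero.2 (hinj.ne hij))
        linarith
      filter_upwards [Ioo_mem_nhdsGT this] with δ hδ _
      linarith [hδ.2]
  obtain ⟨δ, ⟨⟨hδs, hδd⟩, hδε⟩⟩ := (((eventually_all.2 fun c =>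
    eventually_forall_of_eventually_nhds (hsign' c)).and (eventually_all.2 fun i =>
      eventually_all.2 fun j => hdisj i j)).and (Ioo_mem_nhdsGT hε)).exists
  have hδ : 0 < δ := hδε.1
  choose u hu1 hu2 using fun i => exists_rat_btwn (show S i - δ < S i by linarith)
  choose v hv1 hv2 using fun i => exists_rat_btwn (show S i < S i + δ by linarith)
  have hIoo (i) (r : ℝ) (hr : r ∈ Set.Ioo (u i : ℝ) (v i)) : |r - S i| < δ := by
    rw [abs_lt]
    have := hr.1; have := hr.2; have := hu1 i; have := hv2 i
    constructor <;> linarith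
  have hrange (c) (y : ℝ) (hy : y ∈ Set.Icc (l c : ℝ) (h c)) : |y - a c| < ε := by
    rw [abs_lt]
    have := hy.1; have := hy.2; have := hl1 c; have := hh2 c
    constructor <;> linarith
  let D : ImplicitData F s n := ⟨q, u, v, l, h⟩
  have hSD : S ∈ D.box := fun i => ⟨hu2 i, hv1 i⟩
  have hD : D.Valid := by
    refine ⟨fun i j r hi hj => ?_, fun c => ((hl2 c).trans (hh1 c)).le,
      fun c t ht => hδs c t fun i => hIoo i _ (ht i),
      fun c t ht y hy => hεy c t y (fun i => (hIoo i _ (ht i)).trans hδε.2) (hrange c y hy),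
      fun i => ⟨γ i, fun t ht y hy =>
        hεt i t y (fun i => (hIoo i _ (ht i)).trans hδε.2) (hrange _ y hy)⟩⟩
    by_contra hij
    have h1 := hδd i j hij
    have h2 := abs_lt.1 (hIoo i r hi)
    have h3 := abs_lt.1 (hIoo j r hj)
    have h4 : |S i - S j| < 2 * δ := by
      rw [abs_lt]
      constructor <;> linarith [h2.1, h2.2, h3.1, h3.2]
    linarith
  have hsol (c) : a c = D.sol S c := by
    have hmem : a c ∈ D.range c := ⟨(hl2 c).le, (hh1 c).le⟩
    exact hD.eq_sol hSD hmem (hq0 c)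
  exact ⟨s, D, S, hD, hSD, hST, (funext hsol).symm⟩

open MvPolynomial in
/-- If the zero hypergraph of a polynomial over `F` has no proper coloring with `κ` colors, then some
edge consists of solutions of one valid system, with parameters separated by few coordinates. -/
theorem exists_edge_of_not_properlyColorable {κ : Cardinal.{0}} (hκ : ℵ₀ ≤ κ) {k n : ℕ}
    (hk : 2 ≤ k) {F : Type} [Field F] [CharZero F] [Countable F] [Algebra F ℝ] {T : Set ℝ}
    (hT : IsTranscendenceBasis F ((↑) : T → ℝ)) (p : MvPolynomial (Fin k × Fin n) F)
    (hp : ¬ ProperlyColorable (zeroEdges k n (map (algebraMap F ℝ) p)) κ) :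
    ∃ (s : ℕ) (D : ImplicitData F s n) (S : Fin k → Fin s → ℝ) (I : Finset (Fin s)),
      D.Valid ∧ (∀ l, S l ∈ D.box) ∧ (∀ l i, S l i ∈ T) ∧
      aeval (fun v => D.sol (S v.1) v.2) p = 0 ∧ I.card ≤ k - 1 ∧
      Order.succ^[I.card] κ ≤ #ℝ ∧ ∀ l l', (∀ i ∈ I, S l i = S l' i) → l = l' := by
  classical
  choose ψ hψ using fun s => exists_coloring_template hκ s k hk ℝ
  choose s D S hD hS hST hsol using fun a : Fin n → ℝ => ImplicitData.exists_valid hT a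
  let col (a : Fin n → ℝ) : Σ s, ImplicitData F s n × κ.out := ⟨s a, D a, ψ _ (S a)⟩
  have hcol (a) (c) (h : col a = c) : ∃ S : Fin c.1 → ℝ, c.2.1.Valid ∧ S ∈ c.2.1.box ∧
      (∀ i, S i ∈ T) ∧ c.2.1.sol S = a ∧ ψ c.1 S = c.2.2 := by
    subst h
    exact ⟨S a, hD a, hS a, hST a, hsol a, rfl⟩
  have hcard : #(Σ s, ImplicitData F s n × κ.out) ≤ κ := by
    rw [mk_sigma]
    refine (sum_le_mk_mul_iSup _).trans ?_
    refine (mul_le_mul' (mk_le_aleph0.trans hκ) (ciSup_le' fun s => ?_)).trans (mul_eq_self hκ).le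
    rw [mk_prod, lift_id, lift_id, mk_out]
    exact (mul_le_mul' (mk_le_aleph0.trans hκ) le_rfl).trans (mul_eq_self hκ).le
  by_contra hcon
  refine hp ⟨_, col, hcard, fun e he => ?_⟩
  by_contra! hmono
  obtain ⟨a, ha, rfl, h0⟩ := he
  have hmem (l) : a l ∈ fimg a Finset.univ := by
    simp [fimg]
  let l₀ : Fin k := ⟨0, by omega⟩
  choose S' hD' hS' hST' hsol' hψ' using fun l =>
    hcol (a l) (col (a l₀)) (hmono _ (hmem l) _ (hmem l₀))
  have hS'inj : Function.Injective S' := fun l l' h => ha (by rw [← hsol', ← hsol' l', h])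
  obtain ⟨I, hI, hIκ, hsep⟩ := hψ _ (Finset.univ.image S')
    (by rw [Finset.card_image_of_injective _ hS'inj, Finset.card_univ, Fintype.card_fin])
    (by
      simp only [Finset.mem_image]
      rintro _ ⟨l, -, rfl⟩ _ ⟨l', -, rfl⟩
      rw [hψ', hψ'])
  refine hcon ⟨_, (col (a l₀)).2.1, S', I, hD' l₀, hS', hST', ?_, hI, hIκ, fun l l' h => ?_⟩
  · simp only [hsol']
    rwa [eval_map] at h0
  · exact hS'inj (hsep _ (Finset.mem_image_of_mem _ (Finset.mem_univ _)) _
      (Finset.mem_image_of_mem _ (Finset.mem_univ _)) h)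

theorem mem_fimg {V W : Type*} {g : V → W} {e : Finset V} {w : W} :
    w ∈ fimg g e ↔ ∃ v ∈ e, g v = w := by
  simp [fimg]

theorem card_fimg {V W : Type*} {g : V → W} {e : Finset V} (hg : Set.InjOn g e) :
    (fimg g e).card = e.card :=
  @Finset.card_image_of_injOn _ _ _ _ (Classical.decEq W) hg

/-- Edges of a template hypergraph inherit an enumeration from the template. -/
theorem exists_enumeration_of_mem_LEdges {k d : ℕ} {α X : Type*} {S : Fin k → Fin d → α}
    {Q : Finset (Fin d → X)} (hQ : Q ∈ LEdges k (fimg S Finset.univ) X) :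
    ∃ G : Fin k → Fin d → X, Function.Injective G ∧ fimg G Finset.univ = Q ∧
      ∀ l l' i, S l i = S l' i → G l i = G l' i := by
  obtain ⟨hcard, g, hg, hsurj, hcoord⟩ := hQ
  have hmem (l) : S l ∈ fimg S Finset.univ := mem_fimg.2 ⟨l, Finset.mem_univ _, rfl⟩
  have himg : fimg (fun l => g (S l)) Finset.univ = Q := by
    ext y
    refine ⟨fun h => ?_, fun h => ?_⟩
    · obtain ⟨l, -, rfl⟩ := mem_fimg.1 h
      exact hg _ (hmem l)
    · obtain ⟨x, hx, rfl⟩ := hsurj y h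
      obtain ⟨l, -, rfl⟩ := mem_fimg.1 hx
      exact mem_fimg.2 ⟨l, Finset.mem_univ _, rfl⟩
  refine ⟨fun l => g (S l), ?_, himg, fun l l' i h => hcoord _ (hmem l) _ (hmem l') i h⟩
  have hc : (fimg (fun l => g (S l)) Finset.univ).card = (Finset.univ : Finset (Fin k)).card := by
    rw [himg, hcard, Finset.card_fin]
  exact fun l l' h => @Finset.injOn_of_card_image_eq _ _ _ _ (Classical.decEq _) hc
    l (Finset.mem_coe.2 (Finset.mem_univ l)) l' (Finset.mem_coe.2 (Finset.mem_univ l')) h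

theorem fimg_mem_zeroEdges {k n d : ℕ} {α X : Type*} {S : Fin k → Fin d → α}
    {p : MvPolynomial (Fin k × Fin n) ℝ} {f : (Fin d → X) → Fin n → ℝ}
    (hp : ∀ G : Fin k → Fin d → X, (∀ l l' i, S l i = S l' i → G l i = G l' i) →
      MvPolynomial.eval (fun v => f (G v.1) v.2) p = 0)
    {Q : Finset (Fin d → X)} (hQ : Q ∈ LEdges k (fimg S Finset.univ) X) (hf : Set.InjOn f Q) :
    fimg f Q ∈ zeroEdges k n p := by
  obtain ⟨G, hG, rfl, hGS⟩ := exists_enumeration_of_mem_LEdges hQ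
  have hmem (l) : G l ∈ fimg G Finset.univ := mem_fimg.2 ⟨l, Finset.mem_univ _, rfl⟩
  refine ⟨fun l => f (G l), fun l l' h => hG (hf (hmem l) (hmem l') h), ?_, hp G hGS⟩
  ext y
  simp [mem_fimg]

/-- A template hypergraph whose template is separated by few coordinates has large chromatic
number. -/
theorem not_properlyColorable_of_separated {κ : Cardinal.{0}} (hκ : ℵ₀ ≤ κ) {k d e : ℕ}
    {α : Type} {S : Fin k → Fin d → α} (hS : Function.Injective S)
    (J : Fin e → Fin d) (hJ : Function.Injective J)
    (hsep : ∀ l l', (∀ j, S l (J j) = S l' (J j)) → l = l') (hX : Order.succ^[e] κ ≤ #ℝ) :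
    ¬ ProperlyColorable (LEdges k (fimg S Finset.univ) ℝ) κ := by
  rintro ⟨C, φ, hC, hφ⟩
  obtain ⟨Q, hQ, -, hmono⟩ := exists_monochromatic_edge hκ hC (fimg S Finset.univ)
    ((card_fimg hS.injOn).trans (Finset.card_fin k)) J hJ (fun x hx y hy h => by
      obtain ⟨l, -, rfl⟩ := mem_fimg.1 hx
      obtain ⟨l', -, rfl⟩ := mem_fimg.1 hy
      rw [hsep l l' h]) hX φ id (fun a b ⟨i, hi, _⟩ h => hi (congrFun h i))
  obtain ⟨x, hx, y, hy, hxy⟩ := hφ Q hQ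
  exact hxy (hmono x hx y hy)

section IndependentFamily

open MvPolynomial

variable {F : Type} [Field F] [Algebra F ℝ]

theorem AlgebraicIndependent.add_algebraMap {ι : Type*} {x : ι → ℝ}
    (hx : AlgebraicIndependent F x) (r : ι → F) :
    AlgebraicIndependent F fun i => x i + algebraMap F ℝ (r i) := by
  let shift (r : ι → F) : MvPolynomial ι F →ₐ[F] MvPolynomial ι F := aeval fun i => X i + C (r i)
  have hinv : (shift (-r)).comp (shift r) = AlgHom.id F _ := by
    ext i : 1
    simp [shift, MvPolynomial.algebraMap_eq]
  have hcomp : (aeval fun i => x i + algebraMap F ℝ (r i)) = (aeval x).comp (shift r) := by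
    ext i : 1
    simp [shift]
  rw [AlgebraicIndependent, hcomp, AlgHom.coe_comp]
  exact Function.Injective.comp hx (Function.LeftInverse.injective
    (g := shift (-r)) fun q => congrArg (· q) hinv)

theorem cardinalMk_real_le_of_isTranscendenceBasis [Countable F] {T : Set ℝ}
    (hT : IsTranscendenceBasis F ((↑) : T → ℝ)) : #ℝ ≤ #T := by
  have halg := hT.isAlgebraic
  have h1 := Algebra.IsAlgebraic.cardinalMk_le_max (Algebra.adjoin F (Set.range ((↑) : T → ℝ))) ℝ
  have h2 : #(Algebra.adjoin F (Set.range ((↑) : T → ℝ))) ≤ max #T ℵ₀ := by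
    rw [← Cardinal.mk_congr hT.1.aevalEquiv.toEquiv]
    refine MvPolynomial.cardinalMk_le_max.trans ?_
    have : #F ≤ ℵ₀ := Cardinal.mk_le_aleph0
    exact max_le (max_le (this.trans (le_max_right _ _)) (le_max_left _ _)) (le_max_right _ _)
  have h3 : #ℝ ≤ max #T ℵ₀ := h1.trans (max_le h2 (le_max_right _ _))
  refine (le_max_iff.1 h3).resolve_right (not_le.2 ?_)
  rw [Cardinal.mk_real]
  exact Cardinal.aleph0_lt_continuum

theorem exists_algebraicIndependent_mem_Ioo [CharZero F] [Countable F] {T : Set ℝ}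
    (hT : IsTranscendenceBasis F ((↑) : T → ℝ)) {s : ℕ} {u v : Fin s → ℝ} (huv : ∀ i, u i < v i) :
    ∃ e : Fin s × ℝ → ℝ, AlgebraicIndependent F e ∧ ∀ w, e w ∈ Set.Ioo (u w.1) (v w.1) := by
  have hcard : #(Fin s × ℝ) ≤ #T := by
    refine le_trans ?_ (cardinalMk_real_le_of_isTranscendenceBasis hT)
    rw [mk_prod, Cardinal.lift_id, Cardinal.lift_id]
    exact Cardinal.mul_le_of_le (Cardinal.aleph0_le_mk ℝ)
      ((Cardinal.mk_le_aleph0).trans (Cardinal.aleph0_le_mk ℝ)) le_rfl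
  obtain ⟨ε⟩ := hcard
  have hr (w : Fin s × ℝ) : ∃ q : ℚ, u w.1 - ε w < q ∧ (q : ℝ) < v w.1 - ε w :=
    exists_rat_btwn (sub_lt_sub_right (huv w.1) _)
  choose r hr using hr
  refine ⟨_, (hT.1.comp ε ε.injective).add_algebraMap fun w => (r w : F), fun w => ?_⟩
  simp only [Function.comp_apply, map_ratCast]
  exact ⟨sub_lt_iff_lt_add'.1 (hr w).1, lt_sub_iff_add_lt'.1 (hr w).2⟩

end IndependentFamily

namespace ImplicitData

open MvPolynomial

theorem left_lt_right {F : Type} [Field F] {s n : ℕ} {D : ImplicitData F s n}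
    {t : Fin s → ℝ} (ht : t ∈ D.box) (i : Fin s) :
    (D.left i : ℝ) < D.right i := (ht i).1.trans (ht i).2

variable {F : Type} [Field F] [Algebra F ℝ] {s n : ℕ} {D : ImplicitData F s n}

theorem Valid.sol_injective (hD : D.Valid) {T : Set ℝ}
    (hT : AlgebraicIndependent F ((↑) : T → ℝ)) {a b : Fin s → ℝ} (ha : a ∈ D.box)
    (hb : b ∈ D.box) (haT : ∀ i, a i ∈ T) (hbT : ∀ i, b i ∈ T) (h : D.sol a = D.sol b) :
    a = b := by
  classical
  by_contra hab
  obtain ⟨i, hi⟩ := Function.ne_iff.1 hab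
  obtain ⟨r, hr, hra⟩ : ∃ r ∈ Set.Ioo (D.left i : ℝ) (D.right i), r ≠ a i := by
    obtain ⟨r, hr⟩ := exists_between (ha i).2
    exact ⟨r, ⟨(ha i).1.trans hr.1, hr.2⟩, hr.1.ne'⟩
  have hbox : Function.update a i r ∈ D.box := fun j => by
    by_cases hj : j = i
    · subst hj
      simpa using hr
    · simpa [hj] using ha j
  have key : D.sol (Function.update a i r) = D.sol b := by
    ext c
    have := hD.aeval_eq_zero (k := 2) (p := X (0, c) - X (1, c)) hT (S := ![a, b])
      (by simp [Fin.forall_fin_two, ha, hb])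
      (by simp [Fin.forall_fin_two, haT, hbT]) (by simp [h])
      (x := ![Function.update a i r, b]) (by simp [Fin.forall_fin_two, hbox, hb]) (by
        have (j) (hj : a j = b j) : Function.update a i r j = b j := by
          rw [Function.update_of_ne (by rintro rfl; exact hi hj), hj]
        simp only [Fin.forall_fin_two, Matrix.cons_val_zero, Matrix.cons_val_one]
        exact ⟨⟨fun _ _ => trivial, this⟩, fun j hj => (this j hj.symm).symm, fun _ _ => trivial⟩)
    simpa [sub_eq_zero] using this
  refine hD.sol_ne hbox ha (i := i) (by simpa using hra) (fun j hj => by simp [hj]) ?_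
  rw [key, h]

theorem Valid.embeddable [CharZero F] [Countable F] (hD : D.Valid) {T : Set ℝ}
    (hT : IsTranscendenceBasis F ((↑) : T → ℝ)) {k : ℕ} (hk : 0 < k)
    {p : MvPolynomial (Fin k × Fin n) F} {S : Fin k → Fin s → ℝ}
    (hS : ∀ l, S l ∈ D.box) (hST : ∀ l i, S l i ∈ T)
    (h0 : aeval (fun v => D.sol (S v.1) v.2) p = 0) :
    Embeddable (LEdges k (fimg S Finset.univ) ℝ) (zeroEdges k n (map (algebraMap F ℝ) p)) := by
  obtain ⟨e, he, hmem⟩ := exists_algebraicIndependent_mem_Ioo hT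
    (left_lt_right (hS ⟨0, hk⟩))
  have hinj : Function.Injective fun (y : Fin s → ℝ) i => e (i, y i) := fun y z h => by
    ext i
    simpa using he.injective (congrFun h i)
  have hsol : Function.Injective fun y : Fin s → ℝ => D.sol fun i => e (i, y i) := fun y z h =>
    hinj (hD.sol_injective he.coe_range (fun i => hmem (i, y i)) (fun i => hmem (i, z i))
      (fun i => ⟨_, rfl⟩) (fun i => ⟨_, rfl⟩) h)
  refine ⟨_, hsol, fun Q hQ => fimg_mem_zeroEdges (fun G hG => ?_) hQ hsol.injOn⟩
  rw [eval_map, ← aeval_def]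
  exact hD.aeval_eq_zero hT.1 hS hST h0 (x := fun l i => e (i, G l i))
    (fun l i => hmem (i, G l i))
    fun l l' i h => by rw [hG l l' i h]

end ImplicitData

/-- `g` is represented by a term, for valuations whose entries from `N` on are given by `π`. -/
def TermDefinable (N : ℕ) (π : ℕ → ℝ) (g : (ℕ → ℝ) → ℝ) : Prop :=
  ∃ t : OFTerm, ∀ v : ℕ → ℝ, (∀ i, N ≤ i → v i = π i) → t.eval v = g v

/-- `R` is represented by a formula, for valuations whose entries from `N` on are given by `π`. -/
def FmlDefinable (N : ℕ) (π : ℕ → ℝ) (R : (ℕ → ℝ) → Prop) : Prop :=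
  ∃ θ : OFFml, ∀ v : ℕ → ℝ, (∀ i, N ≤ i → v i = π i) → (θ.Realize v ↔ R v)

namespace TermDefinable

variable {N : ℕ} {π : ℕ → ℝ} {g h : (ℕ → ℝ) → ℝ}

theorem var (N : ℕ) (π : ℕ → ℝ) (i : ℕ) : TermDefinable N π fun v => v i :=
  ⟨.var i, fun _ _ => rfl⟩

theorem param {i : ℕ} (hi : N ≤ i) : TermDefinable N π fun _ => π i :=
  ⟨.var i, fun _ hv => hv i hi⟩

theorem zero (N : ℕ) (π : ℕ → ℝ) : TermDefinable N π fun _ => 0 := ⟨.zero, fun _ _ => rfl⟩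

theorem one (N : ℕ) (π : ℕ → ℝ) : TermDefinable N π fun _ => 1 := ⟨.one, fun _ _ => rfl⟩

theorem add (hg : TermDefinable N π g) (hh : TermDefinable N π h) :
    TermDefinable N π fun v => g v + h v := by
  obtain ⟨s, hs⟩ := hg
  obtain ⟨t, ht⟩ := hh
  exact ⟨.add s t, fun v hv => congrArg₂ (· + ·) (hs v hv) (ht v hv)⟩

theorem mul (hg : TermDefinable N π g) (hh : TermDefinable N π h) :
    TermDefinable N π fun v => g v * h v := by
  obtain ⟨s, hs⟩ := hg
  obtain ⟨t, ht⟩ := hh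
  exact ⟨.mul s t, fun v hv => congrArg₂ (· * ·) (hs v hv) (ht v hv)⟩

theorem neg (hg : TermDefinable N π g) : TermDefinable N π fun v => -g v := by
  obtain ⟨s, hs⟩ := hg
  exact ⟨.neg s, fun v hv => congrArg (-·) (hs v hv)⟩

theorem sub (hg : TermDefinable N π g) (hh : TermDefinable N π h) :
    TermDefinable N π fun v => g v - h v := by
  simpa only [sub_eq_add_neg] using hg.add hh.neg

theorem sum {ι : Type*} (s : Finset ι) {g : ι → (ℕ → ℝ) → ℝ}
    (hg : ∀ i ∈ s, TermDefinable N π (g i)) : TermDefinable N π fun v => ∑ i ∈ s, g i v := by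
  induction s using Finset.cons_induction with
  | empty => simpa using zero N π
  | cons a s ha ih =>
    simp only [Finset.sum_cons]
    exact (hg a (Finset.mem_cons_self a s)).add (ih fun i hi => hg i (Finset.mem_cons_of_mem hi))

theorem aeval {F σ : Type*} [CommSemiring F] [Algebra F ℝ]
    (hF : ∀ c : F, ∃ j, N ≤ j ∧ π j = algebraMap F ℝ c) (q : MvPolynomial σ F)
    {g : σ → (ℕ → ℝ) → ℝ} (hg : ∀ i, TermDefinable N π (g i)) :
    TermDefinable N π fun v => MvPolynomial.aeval (fun i => g i v) q := by
  induction q using MvPolynomial.induction_on with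
  | C c =>
    obtain ⟨j, hj, hc⟩ := hF c
    simpa only [MvPolynomial.aeval_C, ← hc] using param hj
  | add p q hp hq => simpa only [map_add] using hp.add hq
  | mul_X p i hp => simpa only [map_mul, MvPolynomial.aeval_X] using hp.mul (hg i)

theorem ratCast {F : Type*} [Field F] [CharZero F] [Algebra F ℝ]
    (hF : ∀ c : F, ∃ j, N ≤ j ∧ π j = algebraMap F ℝ c) (q : ℚ) :
    TermDefinable N π fun _ => (q : ℝ) := by
  obtain ⟨j, hj, hc⟩ := hF q
  simpa only [hc, map_ratCast] using param (π := π) hj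

end TermDefinable

namespace FmlDefinable

variable {N : ℕ} {π : ℕ → ℝ} {g h : (ℕ → ℝ) → ℝ} {R R' : (ℕ → ℝ) → Prop}

theorem eq (hg : TermDefinable N π g) (hh : TermDefinable N π h) :
    FmlDefinable N π fun v => g v = h v := by
  obtain ⟨s, hs⟩ := hg
  obtain ⟨t, ht⟩ := hh
  exact ⟨.eq s t, fun v hv => by rw [OFFml.Realize, hs v hv, ht v hv]⟩

theorem le (hg : TermDefinable N π g) (hh : TermDefinable N π h) :
    FmlDefinable N π fun v => g v ≤ h v := by
  obtain ⟨s, hs⟩ := hg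
  obtain ⟨t, ht⟩ := hh
  exact ⟨.le s t, fun v hv => by rw [OFFml.Realize, hs v hv, ht v hv]⟩

theorem not (hR : FmlDefinable N π R) : FmlDefinable N π fun v => ¬ R v := by
  obtain ⟨θ, hθ⟩ := hR
  exact ⟨.not θ, fun v hv => not_congr (hθ v hv)⟩

theorem and (hR : FmlDefinable N π R) (hR' : FmlDefinable N π R') :
    FmlDefinable N π fun v => R v ∧ R' v := by
  obtain ⟨θ, hθ⟩ := hR
  obtain ⟨θ', hθ'⟩ := hR'
  exact ⟨.and θ θ', fun v hv => and_congr (hθ v hv) (hθ' v hv)⟩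

theorem or (hR : FmlDefinable N π R) (hR' : FmlDefinable N π R') :
    FmlDefinable N π fun v => R v ∨ R' v := by
  simpa only [or_iff_not_and_not] using (hR.not.and hR'.not).not

theorem forall_mem {ι : Type*} (s : Finset ι) {R : ι → (ℕ → ℝ) → Prop}
    (hR : ∀ i ∈ s, FmlDefinable N π (R i)) : FmlDefinable N π fun v => ∀ i ∈ s, R i v := by
  induction s using Finset.cons_induction with
  | empty => simpa using eq (TermDefinable.zero N π) (TermDefinable.zero N π)
  | cons a s ha ih =>
    simp only [Finset.forall_mem_cons]
    exact (hR a (Finset.mem_cons_self a s)).and (ih fun i hi => hR i (Finset.mem_cons_of_mem hi))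

theorem forall_fintype {ι : Type*} [Fintype ι] {R : ι → (ℕ → ℝ) → Prop}
    (hR : ∀ i, FmlDefinable N π (R i)) : FmlDefinable N π fun v => ∀ i, R i v := by
  simpa using forall_mem Finset.univ fun i _ => hR i

theorem exists_update {i : ℕ} (hi : i < N) (hR : FmlDefinable N π R) :
    FmlDefinable N π fun v => ∃ r, R (Function.update v i r) := by
  obtain ⟨θ, hθ⟩ := hR
  exact ⟨.ex i θ, fun v hv => exists_congr fun r => hθ _ fun j hj => by
    rw [Function.update_of_ne (hi.trans_le hj).ne', hv j hj]⟩

theorem exists_block {M m : ℕ} (hm : M + m ≤ N) (hR : FmlDefinable N π R) :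
    FmlDefinable N π fun v =>
      ∃ w : ℕ → ℝ, (∀ j, ¬ (M ≤ j ∧ j < M + m) → w j = v j) ∧ R w := by
  induction m with
  | zero =>
    have (v : ℕ → ℝ) : (∃ w : ℕ → ℝ, (∀ j, ¬ (M ≤ j ∧ j < M + 0) → w j = v j) ∧ R w) ↔ R v := by
      refine ⟨fun ⟨w, hw, h⟩ => ?_, fun h => ⟨v, fun _ _ => rfl, h⟩⟩
      have : w = v := funext fun j => hw j (by lia)
      rwa [← this]
    simpa only [this] using hR
  | succ m ih =>
    convert exists_update (i := M + m) (by lia) (ih (by lia)) using 2 with v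
    refine ⟨fun ⟨w, hw, h⟩ => ⟨w (M + m), w, fun j hj => ?_, h⟩, fun ⟨r, w, hw, h⟩ =>
      ⟨w, fun j hj => ?_, h⟩⟩
    · by_cases hjm : j = M + m
      · subst hjm
        simp
      · rw [Function.update_of_ne hjm, hw j (by lia)]
    · rw [hw j (by lia), Function.update_of_ne (by lia)]

end FmlDefinable

/-- A semialgebraic bijection from `ℝ` onto the interval `(u, v)`. -/
noncomputable def squash (u v z : ℝ) : ℝ := (u + v + (v - u) * (z / (1 + |z|))) / 2

theorem squash_mem_Ioo {u v : ℝ} (h : u < v) (z : ℝ) : squash u v z ∈ Set.Ioo u v := by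
  have hpos : 0 < 1 + |z| := by positivity
  have h1 : z / (1 + |z|) < 1 := by
    rw [div_lt_one hpos]
    linarith [le_abs_self z]
  have h2 : -1 < z / (1 + |z|) := by
    rw [lt_div_iff₀ hpos]
    linarith [neg_abs_le z]
  constructor <;> rw [squash] <;> nlinarith

theorem eq_squash_iff {u v z t : ℝ} :
    t = squash u v z ↔ (0 ≤ z ∧ (2 * t - (u + v)) * (1 + z) = (v - u) * z) ∨
      (z ≤ 0 ∧ (2 * t - (u + v)) * (1 - z) = (v - u) * z) := by
  have hpos : 0 < 1 + |z| := by positivity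
  have key : t = squash u v z ↔ (2 * t - (u + v)) * (1 + |z|) = (v - u) * z := by
    rw [squash, eq_div_iff two_ne_zero, ← sub_eq_iff_eq_add', ← mul_div_assoc,
      eq_div_iff hpos.ne', mul_comm t]
  rw [key]
  rcases le_total 0 z with h | h
  · rw [abs_of_nonneg h]
    refine ⟨fun h' => .inl ⟨h, h'⟩, ?_⟩
    rintro (⟨-, h'⟩ | ⟨hz, h'⟩)
    · exact h'
    · obtain rfl := le_antisymm hz h
      simpa using h'
  · rw [abs_of_nonpos h, ← sub_eq_add_neg]
    refine ⟨fun h' => .inr ⟨h, h'⟩, ?_⟩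
    rintro (⟨hz, h'⟩ | ⟨-, h'⟩)
    · obtain rfl := le_antisymm h hz
      simpa using h'
    · exact h'

theorem squash_injective {u v : ℝ} (h : u < v) : Function.Injective (squash u v) := by
  have key {a b : ℝ} (hab : a / (1 + |a|) = b / (1 + |b|)) (ha : 0 ≤ a) : a = b := by
    have hb : 0 ≤ b := by
      have : 0 ≤ b / (1 + |b|) := hab ▸ by positivity
      exact not_lt.1 fun hb => this.not_gt (div_neg_of_neg_of_pos hb (by positivity))
    rw [abs_of_nonneg ha, abs_of_nonneg hb, div_eq_div_iff (by positivity) (by positivity)] at hab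
    linarith
  intro a b hab
  have hab : a / (1 + |a|) = b / (1 + |b|) := by
    simp only [squash] at hab
    refine mul_left_cancel₀ (sub_pos.2 h).ne' ?_
    linarith
  rcases le_total 0 a with ha | ha
  · exact key hab ha
  · refine neg_injective (key ?_ (neg_nonneg.2 ha))
    rw [abs_neg, abs_neg, neg_div, neg_div, hab]

namespace ImplicitData

open MvPolynomial

/-- The solution of a system of equations as a function of arbitrary real coordinates; the parameter
with index `i` is governed by the coordinates `j` with `ι j = i`. -/
noncomputable def squashSol {F : Type} [Field F] [Algebra F ℝ] {d s n : ℕ}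
    (D : ImplicitData F s n) (ι : Fin d → Fin s) (y : Fin d → ℝ) : Fin n → ℝ :=
  D.sol fun i => squash (D.left i) (D.right i) (∑ j with ι j = i, y j)

theorem squash_mem_box {F : Type} [Field F] {s n : ℕ} {D : ImplicitData F s n}
    (h : ∀ i, (D.left i : ℝ) < D.right i) (z : Fin s → ℝ) :
    (fun i => squash (D.left i) (D.right i) (z i)) ∈ D.box :=
  fun i => squash_mem_Ioo (h i) (z i)

variable {F : Type} [Field F] [Algebra F ℝ] {d s n : ℕ} {D : ImplicitData F s n}

theorem Valid.oneToOneEachCoord_squashSol (hD : D.Valid) (h : ∀ i, (D.left i : ℝ) < D.right i)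
    (ι : Fin d → Fin s) : OneToOneEachCoord (D.squashSol ι) := by
  rintro a b ⟨i, hi, hj⟩
  refine hD.sol_ne (squash_mem_box h _) (squash_mem_box h _) (i := ι i) ?_ fun j hji => ?_
  · refine (squash_injective (h _)).ne fun heq => hi ?_
    have hmem : i ∈ Finset.univ.filter fun j => ι j = ι i := by simp
    rw [← Finset.add_sum_erase _ _ hmem, ← Finset.add_sum_erase _ _ hmem,
      Finset.sum_congr rfl fun j hj' => hj j (Finset.ne_of_mem_erase hj')] at heq
    exact add_right_cancel heq
  · congr 1
    refine Finset.sum_congr rfl fun l hl => hj l ?_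
    rintro rfl
    exact hji (Finset.mem_filter.1 hl).2.symm

theorem Valid.isImmersion_squashSol (hD : D.Valid) (h : ∀ i, (D.left i : ℝ) < D.right i)
    (ι : Fin d → Fin s) {T : Set ℝ} (hT : AlgebraicIndependent F ((↑) : T → ℝ)) {k : ℕ}
    {p : MvPolynomial (Fin k × Fin n) F} {S : Fin k → Fin s → ℝ}
    (hS : ∀ l, S l ∈ D.box) (hST : ∀ l i, S l i ∈ T)
    (h0 : aeval (fun v => D.sol (S v.1) v.2) p = 0) :
    IsImmersion k (fimg (fun l => S l ∘ ι) Finset.univ)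
      (zeroEdges k n (map (algebraMap F ℝ) p)) (D.squashSol ι) := by
  refine ⟨hD.oneToOneEachCoord_squashSol h ι, fun Q hQ hinj =>
    fimg_mem_zeroEdges (fun G hG => ?_) hQ hinj⟩
  rw [eval_map, ← aeval_def]
  refine hD.aeval_eq_zero hT hS hST h0
    (x := fun l i => squash (D.left i) (D.right i) (∑ j with ι j = i, G l j))
    (fun l => squash_mem_box h fun i => ∑ j with ι j = i, G l j) fun l l' i hi => ?_
  congr 1
  refine Finset.sum_congr rfl fun j hj => hG l l' j ?_
  rw [Function.comp_apply, Function.comp_apply, (Finset.mem_filter.1 hj).2, hi]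

theorem Valid.sol_eq_iff (hD : D.Valid) {t : Fin s → ℝ} (ht : t ∈ D.box) {x : Fin n → ℝ} :
    D.sol t = x ↔ ∀ c, ((D.lower c : ℝ) ≤ x c ∧ x c ≤ D.upper c) ∧
      aeval (point t (x c)) (D.poly c) = 0 := by
  refine ⟨?_, fun h => funext fun c => ?_⟩
  · rintro rfl c
    exact ⟨hD.sol_mem ht c, hD.aeval_sol ht c⟩
  · have h1 : x c ∈ D.range c := (h c).1
    have h2 := (h c).2
    exact (hD.eq_sol ht h1 h2).symm

theorem Valid.isSemialgebraicGraph_squashSol [CharZero F] [Countable F] (hD : D.Valid)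
    (h : ∀ i, (D.left i : ℝ) < D.right i) (ι : Fin d → Fin s) :
    IsSemialgebraicGraph d n (D.squashSol ι) := by
  obtain ⟨enum, henum⟩ := exists_surjective_nat F
  let N := d + n + s
  let π (i : ℕ) : ℝ := algebraMap F ℝ (enum (i - N))
  have hF (c : F) : ∃ j, N ≤ j ∧ π j = algebraMap F ℝ c := by
    obtain ⟨j, rfl⟩ := henum c
    exact ⟨N + j, by lia, by simp [π]⟩
  have hvar := TermDefinable.var N π
  have hrat := TermDefinable.ratCast (π := π) hF
  have hsquash (i : Fin s) : FmlDefinable N π fun w =>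
      w (d + n + i) = squash (D.left i) (D.right i) (∑ j with ι j = i, w j) := by
    have hsum : TermDefinable N π fun w => ∑ j with ι j = i, w j :=
      TermDefinable.sum _ fun j _ => hvar j
    have hleft : TermDefinable N π fun w =>
        2 * w (d + n + i) - ((D.left i : ℝ) + (D.right i : ℝ)) := by
      simpa using ((hrat 2).mul (hvar _)).sub ((hrat _).add (hrat _))
    have hright := ((hrat (D.right i)).sub (hrat (D.left i))).mul hsum
    have hzero := TermDefinable.zero N π
    have hone := TermDefinable.one N π
    simp only [eq_squash_iff]
    exact ((FmlDefinable.le hzero hsum).and (FmlDefinable.eq (hleft.mul (hone.add hsum)) hright)).or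
      ((FmlDefinable.le hsum hzero).and (FmlDefinable.eq (hleft.mul (hone.sub hsum)) hright))
  have hpoly (c : Fin n) : FmlDefinable N π fun w =>
      ((D.lower c : ℝ) ≤ w (d + c) ∧ w (d + c) ≤ D.upper c) ∧
        aeval (point (fun i => w (d + n + i)) (w (d + c))) (D.poly c) = 0 := by
    refine ((FmlDefinable.le (hrat _) (hvar _)).and (FmlDefinable.le (hvar _) (hrat _))).and
      (FmlDefinable.eq (TermDefinable.aeval hF _ (g := fun o w =>
        point (fun i => w (d + n + i)) (w (d + c)) o) ?_) (TermDefinable.zero N π))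
    rintro (_ | i)
    · exact hvar _
    · exact hvar _
  obtain ⟨θ, hθ⟩ := FmlDefinable.exists_block (M := d + n) le_rfl
    ((FmlDefinable.forall_fintype hsquash).and (FmlDefinable.forall_fintype hpoly))
  refine ⟨θ, π, fun z x => ?_⟩
  rw [hθ _ fun i hi => by rw [dif_neg (by lia), dif_neg (by lia)]]
  set v : ℕ → ℝ := fun i => if h : i < d then z ⟨i, h⟩
    else if h' : i - d < n then x ⟨i - d, h'⟩ else π i with hv
  have hz (j : Fin d) : v j = z j := by simp [hv]
  have hx (c : Fin n) : v (d + c) = x c := by simp [hv]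
  rw [squashSol, hD.sol_eq_iff (squash_mem_box h _)]
  constructor
  · intro hsol
    let w (i : ℕ) : ℝ := if hi : d + n ≤ i ∧ i < d + n + s then
      squash (D.left ⟨i - (d + n), by lia⟩) (D.right ⟨i - (d + n), by lia⟩)
        (∑ j with ι j = ⟨i - (d + n), by lia⟩, z j) else v i
    have hw (j : ℕ) (hj : ¬ (d + n ≤ j ∧ j < d + n + s)) : w j = v j := dif_neg hj
    have hwz (j : Fin d) : w j = z j := by rw [hw _ (by lia), hz]
    have hwx (c : Fin n) : w (d + c) = x c := by rw [hw _ (by lia), hx]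
    have hwi (i : Fin s) : w (d + n + i) =
        squash (D.left i) (D.right i) (∑ j with ι j = i, z j) := by simp [w]
    refine ⟨w, hw, fun i => by simp only [hwi, hwz], fun c => ?_⟩
    simpa only [hwx, hwi] using hsol c
  · rintro ⟨w, hw, hws, hwp⟩ c
    have hwz (j : Fin d) : w j = z j := by rw [hw _ (by lia), hz]
    have hwx (c : Fin n) : w (d + c) = x c := by rw [hw _ (by lia), hx]
    have := hwp c
    simpa only [hwx, hws, hwz] using this

end ImplicitData

theorem card_of_mem_zeroEdges {k n : ℕ} {p : MvPolynomial (Fin k × Fin n) ℝ}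
    {e : Finset (Fin n → ℝ)} (he : e ∈ zeroEdges k n p) : e.card = k := by
  obtain ⟨a, ha, rfl, -⟩ := he
  rw [card_fimg ha.injOn, Finset.card_fin]

theorem Embeddable.properlyColorable {V W : Type} {E₁ : Set (Finset V)} {E₂ : Set (Finset W)}
    (h : Embeddable E₁ E₂) {κ : Cardinal.{0}} (hκ : ProperlyColorable E₂ κ) :
    ProperlyColorable E₁ κ := by
  obtain ⟨g, -, hg⟩ := h
  obtain ⟨C, φ, hC, hφ⟩ := hκ
  refine ⟨C, φ ∘ g, hC, fun e he => ?_⟩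
  obtain ⟨x, hx, y, hy, hxy⟩ := hφ _ (hg e he)
  obtain ⟨a, ha, rfl⟩ := mem_fimg.1 hx
  obtain ⟨b, hb, rfl⟩ := mem_fimg.1 hy
  exact ⟨a, ha, b, hb, hxy⟩

theorem IsImmersion.properlyColorable {κ : Cardinal.{0}} (hκ : ℵ₀ ≤ κ) {k d : ℕ} (hk : 2 ≤ k)
    {α V X : Type} [Nonempty X] {P : Finset (Fin d → α)} (hP : P.card = k) {E : Set (Finset V)}
    {f : (Fin d → X) → V} (hf : IsImmersion k P E f) (hE : ProperlyColorable E κ) :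
    ProperlyColorable (LEdges k P X) κ := by
  by_contra hcol
  obtain ⟨ψ, hψ⟩ := exists_coloring_template hκ d k hk X
  have hbad : ∃ Q ∈ LEdges k P X, ∀ x ∈ Q, ∀ y ∈ Q, ψ x = ψ y := by
    by_contra! h
    exact hcol ⟨κ.out, ψ, (mk_out κ).le, h⟩
  obtain ⟨Q, ⟨hQ, g, hg, hsurj, hcoord⟩, hmono⟩ := hbad
  obtain ⟨I, -, hI, hsep⟩ := hψ Q hQ hmono
  have hginj : Set.InjOn g P := by
    have himg : fimg g P = Q := by
      ext y
      refine ⟨fun h => ?_, fun h => mem_fimg.2 (hsurj y h)⟩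
      obtain ⟨x, hx, rfl⟩ := mem_fimg.1 h
      exact hg x hx
    exact @Finset.injOn_of_card_image_eq _ _ _ _ (Classical.decEq _)
      ((congrArg Finset.card himg).trans (hQ.trans hP.symm))
  obtain ⟨C, φ, hC, hφ⟩ := hE
  obtain ⟨R, hR, hinj, hRmono⟩ := exists_monochromatic_edge hκ hC P hP
    (fun j => (I.equivFin.symm j : Fin d)) (Subtype.val_injective.comp I.equivFin.symm.injective)
    (fun x hx y hy h => hginj hx hy (hsep _ (hg x hx) _ (hg y hy) fun i hi => by
      have := h (I.equivFin ⟨i, hi⟩)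
      rw [Equiv.symm_apply_apply] at this
      exact hcoord x hx y hy i this)) hI (φ ∘ f) f hf.1
  obtain ⟨x, hx, y, hy, hxy⟩ := hφ _ (hf.2 R hR hinj)
  obtain ⟨a, ha, rfl⟩ := mem_fimg.1 hx
  obtain ⟨b, hb, rfl⟩ := mem_fimg.1 hy
  exact hxy (hRmono a ha b hb)

/-- Every real polynomial has coefficients in some countable field. -/
theorem MvPolynomial.exists_countable_field {σ : Type} (p : MvPolynomial σ ℝ) :
    ∃ (F : Subfield ℝ) (q : MvPolynomial σ F), Countable F ∧ map (algebraMap F ℝ) q = p := by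
  let F : Subfield ℝ := Subfield.closure p.coeffs
  have hp : p ∈ Set.range (map (algebraMap F ℝ)) :=
    mem_range_map_iff_coeffs_subset.2 fun c hc => ⟨⟨c, Subfield.subset_closure hc⟩, rfl⟩
  obtain ⟨q, hq⟩ := hp
  refine ⟨F, q, ?_, hq⟩
  rw [← Cardinal.mk_le_aleph0_iff]
  refine (Subfield.cardinalMk_closure_le_max _).trans (max_le ?_ le_rfl)
  exact Cardinal.mk_le_aleph0

/-- A coordinate choice of the given length that covers a small nonempty set of coordinates. -/
theorem Finset.exists_enumeration_of_card_le {s m : ℕ} {I : Finset (Fin s)} (hI : I.Nonempty)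
    (hm : I.card ≤ m) : ∃ (ι : Fin m → Fin s) (J : Fin I.card → Fin m),
      Function.Injective J ∧ ∀ i ∈ I, ∃ j, ι (J j) = i := by
  refine ⟨fun j => if h : j < I.card then I.equivFin.symm ⟨j, h⟩ else hI.choose, Fin.castLE hm,
    Fin.castLE_injective hm, fun i hi => ⟨I.equivFin ⟨i, hi⟩, by simp⟩⟩

theorem exists_templates_of_not_properlyColorable {κ : Cardinal.{0}} (hκ : ℵ₀ ≤ κ) {k n : ℕ}
    (hk : 2 ≤ k) {p : MvPolynomial (Fin k × Fin n) ℝ}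
    (hp : ¬ ProperlyColorable (zeroEdges k n p) κ) :
    (∃ (d : ℕ) (P : Finset (Fin d → ℝ)), P.card = k ∧
      Embeddable (LEdges k P ℝ) (zeroEdges k n p) ∧ ¬ ProperlyColorable (LEdges k P ℝ) κ) ∧
    ∃ (P : Finset (Fin (k - 1) → ℝ)), P.card = k ∧
      (∃ f : (Fin (k - 1) → ℝ) → (Fin n → ℝ),
        IsImmersion k P (zeroEdges k n p) f ∧ IsSemialgebraicGraph (k - 1) n f) ∧
      ¬ ProperlyColorable (LEdges k P ℝ) κ := by
  obtain ⟨F, q, hF, rfl⟩ := p.exists_countable_field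
  obtain ⟨T, hT⟩ := exists_isTranscendenceBasis F ℝ
  obtain ⟨s, D, S, I, hD, hS, hST, h0, hI, hIκ, hsep⟩ :=
    exists_edge_of_not_properlyColorable hκ hk hT q hp
  have hinj : Function.Injective S := fun l l' h => hsep l l' fun i _ => congrFun h i
  have hlr := ImplicitData.left_lt_right (hS ⟨0, by lia⟩)
  constructor
  · refine ⟨s, fimg S Finset.univ, (card_fimg hinj.injOn).trans (Finset.card_fin k),
      hD.embeddable hT (by lia) hS hST h0, ?_⟩
    refine not_properlyColorable_of_separated hκ hinj
      (fun j => (I.equivFin.symm j : Fin s)) (Subtype.val_injective.comp I.equivFin.symm.injective)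
      (fun l l' h => hsep l l' fun i hi => ?_) hIκ
    have := h (I.equivFin ⟨i, hi⟩)
    rwa [Equiv.symm_apply_apply] at this
  · have hne : I.Nonempty := by
      by_contra h
      rw [Finset.not_nonempty_iff_eq_empty] at h
      subst h
      have := hsep ⟨0, by lia⟩ ⟨1, by lia⟩ (by simp)
      simp at this
    obtain ⟨ι, J, hJ, hIJ⟩ := Finset.exists_enumeration_of_card_le hne hI
    have hsepJ (l l') (h : ∀ j, (S l ∘ ι) (J j) = (S l' ∘ ι) (J j)) : l = l' :=
      hsep l l' fun i hi => by
        obtain ⟨j, rfl⟩ := hIJ i hi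
        exact h j
    have hinj' : Function.Injective fun l => S l ∘ ι := fun l l' h =>
      hsepJ l l' fun j => congrFun h (J j)
    exact ⟨fimg (fun l => S l ∘ ι) Finset.univ,
      (card_fimg hinj'.injOn).trans (Finset.card_fin k),
      ⟨D.squashSol ι, hD.isImmersion_squashSol hlr ι hT.1 hS hST h0,
        hD.isSemialgebraicGraph_squashSol hlr ι⟩,
      not_properlyColorable_of_separated hκ hinj' J hJ hsepJ hIκ⟩

/-- For an algebraic `k`-hypergraph `H` and infinite cardinal `κ`, the following are
equivalent: (1) `χ(H) ≤ κ`; (2) `χ(L(ℝ^d,P)) ≤ κ` for every `d`-dimensional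
`k`-template `P` with `L(ℝ^d,P)` embeddable into `H`; (3) `χ(L(ℝ^{k-1},P)) ≤ κ` for
every `(k-1)`-dimensional `k`-template `P` with `L(ℝ^{k-1},P)` semialgebraically
immersible into `H`. -/
theorem chromatic_le_iff_templates (k n : ℕ) (hk : 2 ≤ k)
    (p : MvPolynomial (Fin k × Fin n) ℝ) (κ : Cardinal.{0}) (hκ : Cardinal.aleph0 ≤ κ) :
    (chromaticNumber (zeroEdges k n p) ≤ κ ↔
      ∀ (d : ℕ) (α : Type) (P : Finset (Fin d → α)), P.card = k →
        Embeddable (LEdges k P ℝ) (zeroEdges k n p) →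
        chromaticNumber (LEdges k P ℝ) ≤ κ) ∧
    (chromaticNumber (zeroEdges k n p) ≤ κ ↔
      ∀ (α : Type) (P : Finset (Fin (k - 1) → α)), P.card = k →
        (∃ f : (Fin (k - 1) → ℝ) → (Fin n → ℝ),
            IsImmersion k P (zeroEdges k n p) f ∧ IsSemialgebraicGraph (k - 1) n f) →
        chromaticNumber (LEdges k P ℝ) ≤ κ) := by
  have hZ : chromaticNumber (zeroEdges k n p) ≤ κ ↔ ProperlyColorable (zeroEdges k n p) κ :=
    chromaticNumber_le_iff fun e he => hk.trans (card_of_mem_zeroEdges he).ge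
  have hL {d : ℕ} {α : Type} (P : Finset (Fin d → α)) :
      chromaticNumber (LEdges k P ℝ) ≤ κ ↔ ProperlyColorable (LEdges k P ℝ) κ :=
    chromaticNumber_le_iff fun e he => hk.trans he.1.ge
  simp only [hZ, hL]
  refine ⟨⟨fun h d α P _ hP => hP.properlyColorable h, fun h => ?_⟩,
    ⟨fun h α P hP ⟨f, hf, _⟩ => hf.properlyColorable hκ hk hP h, fun h => ?_⟩⟩
  · by_contra hcol
    obtain ⟨⟨d, P, hP, hemb, hbad⟩, -⟩ := exists_templates_of_not_properlyColorable hκ hk hcol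
    exact hbad (h d ℝ P hP hemb)
  · by_contra hcol
    obtain ⟨-, P, hP, himm, hbad⟩ := exists_templates_of_not_properlyColorable hκ hk hcol
    exact hbad (h ℝ P hP himm)
end

section
/- Suppose d < ω and X is an infinite set. If f : X^d → C is one-to-one in each coordinate, then for each M < ω there are subsets Y_0, Y_1, …, Y_{d-1} of X, each of cardinality M, such that f is one-to-one on Y_0 × Y_1 × ⋯ × Y_{d-1}. -/
/-- Finitely many sets, each meeting every line parallel to some coordinate axis in at most one
point, do not cover a finite power of an infinite set. -/
theorem exists_forall_notMem_of_fibers_subsingleton {I T X : Type*} [Finite I] [Finite T]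
    [Infinite X] (i : T → I) (B : T → Set (I → X))
    (hB : ∀ t, ∀ y ∈ B t, ∀ z ∈ B t, (∀ j, j ≠ i t → y j = z j) → y = z) :
    ∃ y, ∀ t, y ∉ B t := by
  classical
  cases nonempty_fintype I
  cases nonempty_fintype T
  by_contra! hcover
  choose t ht using hcover
  let e : Fin (Fintype.card T + 1) ↪ X := Fin.valEmbedding.trans (Infinite.natEmbedding X)
  let g : (I → Fin (Fintype.card T + 1)) → T := fun y => t (e ∘ y)
  have : Nonempty I := ⟨i (g fun _ => 0)⟩
  have hcard : Fintype.card T * (Fintype.card T + 1) ^ (Fintype.card I - 1) <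
      Fintype.card (I → Fin (Fintype.card T + 1)) := by
    rw [Fintype.card_fun, Fintype.card_fin, ← mul_pow_sub_one (Fintype.card_ne_zero (α := I))]
    exact Nat.mul_lt_mul_of_pos_right (Nat.lt_succ_self _) (by positivity)
  obtain ⟨s, hs⟩ := Fintype.exists_lt_card_fiber_of_mul_lt_card g hcard
  refine hs.not_ge ?_
  have hinj := Finset.card_le_card_of_injOn (s := {y | g y = s}) (t := Finset.univ)
    (fun (y : I → Fin (Fintype.card T + 1)) (j : {j // j ≠ i s}) => y j)
    (fun _ _ => Finset.mem_coe.2 (Finset.mem_univ _)) (by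
      intro y hy z hz hyz
      simp only [Finset.coe_filter, Finset.mem_univ, true_and, Set.mem_ofPred_eq] at hy hz
      refine e.injective.comp_left (hB s _ (hy ▸ ht _) _ (hz ▸ ht _) fun j hj => ?_)
      exact congrArg e (congrFun hyz ⟨j, hj⟩))
  simpa [Fintype.card_subtype_compl] using hinj

/-- If `X` is infinite and `f : X^d → C` is one-to-one in each coordinate, then for
each `M < ω` there are `M`-element subsets `Y₀,…,Y_{d-1}` of `X` such that `f` is
one-to-one on `Y₀ × ⋯ × Y_{d-1}`. -/
theorem one_to_one_on_product {X C : Type*} [Infinite X] (d : ℕ)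
    (f : (Fin d → X) → C) (hf : OneToOneEachCoord f) (M : ℕ) :
    ∃ Y : Fin d → Finset X, (∀ i, (Y i).card = M) ∧
      Set.InjOn f {a : Fin d → X | ∀ i, a i ∈ Y i} := by
  classical
  let T := {p : (Fin d → Fin M) × (Fin d → Fin M) // p.1 ≠ p.2}
  have hdiff : ∀ p : T, ∃ i, p.1.1 i ≠ p.1.2 i := fun p => Function.ne_iff.1 p.2
  choose i hi using hdiff
  obtain ⟨y, hy⟩ := exists_forall_notMem_of_fibers_subsingleton
    (fun p : T => (i p, p.1.1 (i p)))
    (fun p => {y : Fin d × Fin M → X |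
      f (fun j => y (j, p.1.1 j)) = f (fun j => y (j, p.1.2 j))}) (by
    intro p y hy z hz hyz
    have hb : (fun j => y (j, p.1.2 j)) = fun j => z (j, p.1.2 j) := by
      funext j
      refine hyz _ fun h => ?_
      obtain ⟨rfl, h⟩ := Prod.ext_iff.1 h
      exact hi p h.symm
    have ha : f (fun j => y (j, p.1.1 j)) = f (fun j => z (j, p.1.1 j)) :=
      hy.trans ((congrArg f hb).trans hz.symm)
    funext q
    by_cases hq : q = (i p, p.1.1 (i p))
    · subst hq
      by_contra hne
      exact hf _ _ ⟨i p, hne, fun j hj => hyz _ fun h => hj (congrArg Prod.fst h)⟩ ha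
    · exact hyz q hq)
  have hinj : ∀ a b : Fin d → Fin M,
      f (fun j => y (j, a j)) = f (fun j => y (j, b j)) → a = b := by
    intro a b hab
    by_contra hne
    exact hy ⟨(a, b), hne⟩ hab
  refine ⟨fun j => Finset.univ.image fun k => y (j, k), fun j => ?_, ?_⟩
  · rw [Finset.card_image_of_injective, Finset.card_univ, Fintype.card_fin]
    intro k l hkl
    have hupd := hinj (fun _ => k) (Function.update (fun _ => k) j l) (by
      congr 1
      funext j'
      by_cases h : j' = j
      · subst h
        simpa using hkl
      · simp [h])
    simpa using congrFun hupd j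
  · intro a ha b hb hab
    simp only [Finset.mem_image, Finset.mem_univ, true_and, Set.mem_ofPred_eq] at ha hb
    choose k hk using ha
    choose l hl using hb
    obtain rfl := funext hk
    obtain rfl := funext hl
    rw [hinj k l hab]
end

section
/- Suppose m ≤ d < ω and π : {0,…,d-1} → {0,…,m-1} is a surjection, and let P be a d-dimensional k-template. Then for any infinite set X, L(X^d,P) is embeddable into L(X^m,P^π); moreover, L(X^d,P) is isomorphic to a spanning subhypergraph of L(X^m,P^π). -/
open Cardinal

universe u v

/-- The π-collapse of a `d`-tuple: coordinate `j < m` is the restriction of `x`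
to `π ⁻¹ {j}` (recorded as a partial function on `Fin d`). -/
def piCollapse {d m : ℕ} {α : Type*} (π : Fin d → Fin m) (x : Fin d → α) :
    Fin m → (Fin d → Option α) :=
  fun j i => if π i = j then some (x i) else none

/-- The π-collapse `P^π` of a template `P`. -/
noncomputable def collapseT {d m : ℕ} {α : Type*} (π : Fin d → Fin m)
    (P : Finset (Fin d → α)) : Finset (Fin m → (Fin d → Option α)) :=
  @Finset.image _ _ (Classical.decEq _) (piCollapse π) P

theorem card_fimg_of_injective {V W : Type*} {g : V → W} (hg : Function.Injective g)
    (e : Finset V) : (fimg g e).card = e.card :=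
  @Finset.card_image_of_injective _ _ _ (Classical.decEq W) e hg

theorem mem_collapseT {d m : ℕ} {α : Type*} {π : Fin d → Fin m} {P : Finset (Fin d → α)}
    {y : Fin m → (Fin d → Option α)} : y ∈ collapseT π P ↔ ∃ x ∈ P, piCollapse π x = y :=
  mem_fimg

theorem piCollapse_injective {d m : ℕ} {α : Type*} (π : Fin d → Fin m) :
    Function.Injective (piCollapse (α := α) π) := by
  intro x y h
  funext i
  simpa [piCollapse] using congrFun (congrFun h (π i)) i

theorem piCollapse_apply_eq_iff {d m : ℕ} {α : Type*} (π : Fin d → Fin m) (x y : Fin d → α)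
    (j : Fin m) : piCollapse π x j = piCollapse π y j ↔ ∀ i, π i = j → x i = y i := by
  simp only [piCollapse, funext_iff]
  refine forall_congr' fun i => ?_
  by_cases h : π i = j <;> simp [h]

theorem nonempty_equiv_of_finite_fun (ι : Type) [Finite ι] [Nonempty ι] (X : Type u) [Infinite X] :
    Nonempty ((ι → X) ≃ X) := by
  have := Fintype.ofFinite ι
  rw [← Cardinal.lift_mk_eq'.{u, u}]
  have h : #(ι → X) = #X ^ Fintype.card ι := by simp
  rw [h, Cardinal.power_nat_eq (Cardinal.aleph0_le_mk X) Fintype.card_pos]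

/-- If `X` is infinite, there is a bijection `X ^ d → X ^ m` whose `j`-th coordinate depends
only on the coordinates of its argument in `π ⁻¹ {j}`. -/
theorem exists_bijective_collapse (X : Type u) [Infinite X] {d m : ℕ} {π : Fin d → Fin m}
    (hπ : Function.Surjective π) :
    ∃ g : (Fin d → X) → (Fin m → X), Function.Bijective g ∧
      ∀ x y j, (∀ i, π i = j → x i = y i) → g x j = g y j := by
  have (j : Fin m) : Nonempty (({i // π i = j} → X) ≃ X) := by
    obtain ⟨i, hi⟩ := hπ j
    have : Nonempty {i // π i = j} := ⟨⟨i, hi⟩⟩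
    exact nonempty_equiv_of_finite_fun _ X
  have e (j : Fin m) : ({i // π i = j} → X) ≃ X := Classical.choice (this j)
  refine ⟨fun x j => e j fun i => x i, ⟨fun x y h => ?_, fun z => ?_⟩, fun x y j h => ?_⟩
  · funext i
    exact congrFun ((e (π i)).injective (congrFun h (π i))) ⟨i, rfl⟩
  · refine ⟨fun i => (e (π i)).symm (z (π i)) ⟨i, rfl⟩, ?_⟩
    funext j
    rw [← Equiv.eq_symm_apply]
    funext ⟨i, hi⟩
    subst hi
    rfl
  · exact congrArg (e j) (funext fun i => h i i.2)

theorem IsHomImage.fimg_collapseT {d m : ℕ} {α : Type*} {X : Type*} [Nonempty X]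
    {π : Fin d → Fin m} {P : Finset (Fin d → α)} {Q : Finset (Fin d → X)}
    {g : (Fin d → X) → (Fin m → X)}
    (hg : ∀ x y j, (∀ i, π i = j → x i = y i) → g x j = g y j) (h : IsHomImage P Q) :
    IsHomImage (collapseT π P) (fimg g Q) := by
  obtain ⟨f, hmaps, hsurj, heq⟩ := h
  have hext (x : Fin d → α) : Function.extend (piCollapse π) (g ∘ f)
      (fun _ _ => Classical.arbitrary X) (piCollapse π x) = g (f x) :=
    (piCollapse_injective π).extend_apply _ _ x
  refine ⟨Function.extend (piCollapse π) (g ∘ f) fun _ _ => Classical.arbitrary X,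
    ?_, ?_, ?_⟩
  · intro z hz
    obtain ⟨x, hx, rfl⟩ := mem_collapseT.mp hz
    rw [hext]
    exact mem_fimg.mpr ⟨f x, hmaps x hx, rfl⟩
  · intro z hz
    obtain ⟨y, hy, rfl⟩ := mem_fimg.mp hz
    obtain ⟨x, hx, rfl⟩ := hsurj y hy
    exact ⟨piCollapse π x, mem_collapseT.mpr ⟨x, hx, rfl⟩, hext x⟩
  · intro z hz w hw j hzw
    obtain ⟨x, hx, rfl⟩ := mem_collapseT.mp hz
    obtain ⟨y, hy, rfl⟩ := mem_collapseT.mp hw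
    rw [hext, hext]
    exact hg _ _ j fun i hi => heq x hx y hy i ((piCollapse_apply_eq_iff π x y j).mp hzw i hi)

/-- If `m ≤ d`, `π : d → m` is a surjection, `P` is a `d`-dimensional `k`-template and
`X` is infinite, then `L(X^d,P)` is embeddable into `L(X^m,P^π)`; moreover `L(X^d,P)`
is isomorphic to a spanning subhypergraph of `L(X^m,P^π)`. -/
theorem collapse_embeddable {α : Type v} {X : Type u} [Infinite X] (d m k : ℕ)
    (hm : m ≤ d) (π : Fin d → Fin m) (hπ : Function.Surjective π)
    (P : Finset (Fin d → α)) (hP : P.card = k) :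
    Embeddable (LEdges k P X) (LEdges k (collapseT π P) X) ∧
    ∃ g : (Fin d → X) → (Fin m → X), Function.Bijective g ∧
      ∀ e ∈ LEdges k P X, fimg g e ∈ LEdges k (collapseT π P) X := by
  obtain ⟨g, hbij, hg⟩ := exists_bijective_collapse X hπ
  have hedge : ∀ e ∈ LEdges k P X, fimg g e ∈ LEdges k (collapseT π P) X := fun e he =>
    ⟨(card_fimg_of_injective hbij.injective e).trans he.1, he.2.fimg_collapseT hg⟩
  exact ⟨⟨g, hbij.injective, hedge⟩, g, hbij, hedge⟩
end
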